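/- (Comparison theorem.) Let the system F_j(x,u(x),Du_j(x),D²u_j(x)) = 0, j = 1,…,m₁+m₂, be degenerate elliptic and balanced quasi-monotone, and assume conditions (i') and (ii). Let (u₁,u₂) be a bounded sub-super solution and (v₁,v₂) a bounded super-sub solution of the system such that u₁* ≤ v_{1*} on ∂Ω and v₂* ≤ u_{2*} on ∂Ω (componentwise, with the semicontinuous envelopes extended to the closure of Ω by limsup/liminf from Ω). Then u₁* ≤ v_{1*} in Ω and v₂* ≤ u_{2*} in Ω. -/

import Mathlib

open Filter Topology Matrix Bornology

noncomputable section

/-- Euclidean space ℝⁿ. -/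
abbrev En (n : ℕ) := EuclideanSpace ℝ (Fin n)

/-- n×n real matrices (the symmetric ones model 𝒮ⁿ). -/
abbrev Symn (n : ℕ) := Matrix (Fin n) (Fin n) ℝ

/-- Loewner order: `X ≤ Y` iff `Y - X` is positive semidefinite. -/
def LoewnerLE {ι : Type*} [Fintype ι] (X Y : Matrix ι ι ℝ) : Prop := (Y - X).PosSemidef

/-- Upper semicontinuous envelope relative to Ω: f*(x) = limsup_{Ω ∋ y → x} f(y). -/
def uEnv {n : ℕ} (Ω : Set (En n)) (f : En n → ℝ) (x : En n) : ℝ := limsup f (𝓝[Ω] x)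

/-- Lower semicontinuous envelope relative to Ω: f_*(x) = liminf_{Ω ∋ y → x} f(y). -/
def lEnv {n : ℕ} (Ω : Set (En n)) (f : En n → ℝ) (x : En n) : ℝ := liminf f (𝓝[Ω] x)

/-- φ touches f from above at x (within Ω). -/
def TouchAbove {n : ℕ} (Ω : Set (En n)) (φ f : En n → ℝ) (x : En n) : Prop :=
  φ x = f x ∧ ∃ N : Set (En n), IsOpen N ∧ x ∈ N ∧ ∀ y ∈ (N ∩ Ω) \ {x}, f y < φ y

/-- φ touches f from below at x (within Ω). -/
def TouchBelow {n : ℕ} (Ω : Set (En n)) (φ f : En n → ℝ) (x : En n) : Prop :=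
  φ x = f x ∧ ∃ N : Set (En n), IsOpen N ∧ x ∈ N ∧ ∀ y ∈ (N ∩ Ω) \ {x}, φ y < f y

/-- Hessian matrix D²φ(x) of a scalar function. -/
def hess {n : ℕ} (φ : En n → ℝ) (x : En n) : Symn n :=
  Matrix.of fun i j =>
    iteratedFDeriv ℝ 2 φ x ![EuclideanSpace.single i 1, EuclideanSpace.single j 1]

/-- The type of the operators F_j(x, r, s, p, X). -/
abbrev Op (n m₁ m₂ : ℕ) :=
  En n → (Fin m₁ → ℝ) → (Fin m₂ → ℝ) → En n → Symn n → ℝ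

/-- Continuity of an operator on Ω × ℝ^{m₁} × ℝ^{m₂} × ℝⁿ × 𝒮ⁿ. -/
def OpContinuousOn {n m₁ m₂ : ℕ} (Ω : Set (En n)) (F : Op n m₁ m₂) : Prop :=
  ContinuousOn (fun q : En n × (Fin m₁ → ℝ) × (Fin m₂ → ℝ) × En n × Symn n =>
      F q.1 q.2.1 q.2.2.1 q.2.2.2.1 q.2.2.2.2)
    (Ω ×ˢ (Set.univ : Set ((Fin m₁ → ℝ) × (Fin m₂ → ℝ) × En n × Symn n)))

/-- Degenerate ellipticity of an operator. -/
def DegElliptic {n m₁ m₂ : ℕ} (Ω : Set (En n)) (F : Op n m₁ m₂) : Prop :=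
  ∀ x ∈ Ω, ∀ (r : Fin m₁ → ℝ) (s : Fin m₂ → ℝ) (p : En n) (X Y : Symn n),
    X.IsSymm → Y.IsSymm → LoewnerLE X Y → F x r s p Y ≤ F x r s p X

/-- Balanced quasi-monotonicity of the system (F1, F2). -/
def BalancedQM {n m₁ m₂ : ℕ} (Ω : Set (En n))
    (F1 : Fin m₁ → Op n m₁ m₂) (F2 : Fin m₂ → Op n m₁ m₂) : Prop :=
  (∀ j, ∀ x ∈ Ω, ∀ (r : Fin m₁ → ℝ) (s σ : Fin m₂ → ℝ) (p : En n) (X : Symn n), X.IsSymm →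
      (∀ i, s i ≤ σ i) → F1 j x r s p X ≤ F1 j x r σ p X) ∧
  (∀ j, ∀ x ∈ Ω, ∀ (r ρ : Fin m₁ → ℝ) (s : Fin m₂ → ℝ) (p : En n) (X : Symn n), X.IsSymm →
      (∀ i, r i ≤ ρ i) → r j = ρ j → F1 j x ρ s p X ≤ F1 j x r s p X) ∧
  (∀ j, ∀ x ∈ Ω, ∀ (r ρ : Fin m₁ → ℝ) (s : Fin m₂ → ℝ) (p : En n) (X : Symn n), X.IsSymm →
      (∀ i, r i ≤ ρ i) → F2 j x r s p X ≤ F2 j x ρ s p X) ∧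
  (∀ j, ∀ x ∈ Ω, ∀ (r : Fin m₁ → ℝ) (s σ : Fin m₂ → ℝ) (p : En n) (X : Symn n), X.IsSymm →
      (∀ i, s i ≤ σ i) → s j = σ j → F2 j x r σ p X ≤ F2 j x r s p X)

/-- Boundedness of a vector-valued function on Ω. -/
def BddOn {n m : ℕ} (Ω : Set (En n)) (u : En n → Fin m → ℝ) : Prop :=
  ∃ M : ℝ, ∀ x ∈ Ω, ∀ i, |u x i| ≤ M

/-- (u1, u2) is a super-sub solution of the system (F1, F2) in Ω. -/
def SuperSub {n m₁ m₂ : ℕ} (Ω : Set (En n))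
    (F1 : Fin m₁ → Op n m₁ m₂) (F2 : Fin m₂ → Op n m₁ m₂)
    (u1 : En n → Fin m₁ → ℝ) (u2 : En n → Fin m₂ → ℝ) : Prop :=
  BddOn Ω u1 ∧ BddOn Ω u2 ∧
  (∀ j, ∀ x ∈ Ω, ∀ φ : En n → ℝ, ContDiff ℝ 2 φ →
      TouchBelow Ω φ (lEnv Ω fun y => u1 y j) x →
      0 ≤ F1 j x (fun i => lEnv Ω (fun y => u1 y i) x) (fun i => uEnv Ω (fun y => u2 y i) x)
            (gradient φ x) (hess φ x)) ∧
  (∀ j, ∀ x ∈ Ω, ∀ φ : En n → ℝ, ContDiff ℝ 2 φ →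
      TouchAbove Ω φ (uEnv Ω fun y => u2 y j) x →
      F2 j x (fun i => lEnv Ω (fun y => u1 y i) x) (fun i => uEnv Ω (fun y => u2 y i) x)
          (gradient φ x) (hess φ x) ≤ 0)

/-- (u1, u2) is a sub-super solution of the system (F1, F2) in Ω. -/
def SubSuper {n m₁ m₂ : ℕ} (Ω : Set (En n))
    (F1 : Fin m₁ → Op n m₁ m₂) (F2 : Fin m₂ → Op n m₁ m₂)
    (u1 : En n → Fin m₁ → ℝ) (u2 : En n → Fin m₂ → ℝ) : Prop :=
  BddOn Ω u1 ∧ BddOn Ω u2 ∧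
  (∀ j, ∀ x ∈ Ω, ∀ φ : En n → ℝ, ContDiff ℝ 2 φ →
      TouchAbove Ω φ (uEnv Ω fun y => u1 y j) x →
      F1 j x (fun i => uEnv Ω (fun y => u1 y i) x) (fun i => lEnv Ω (fun y => u2 y i) x)
          (gradient φ x) (hess φ x) ≤ 0) ∧
  (∀ j, ∀ x ∈ Ω, ∀ φ : En n → ℝ, ContDiff ℝ 2 φ →
      TouchBelow Ω φ (lEnv Ω fun y => u2 y j) x →
      0 ≤ F2 j x (fun i => uEnv Ω (fun y => u1 y i) x) (fun i => lEnv Ω (fun y => u2 y i) x)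
            (gradient φ x) (hess φ x))

section Regularization

set_option linter.unusedSimpArgs false

variable {E : Type*} [NormedAddCommGroup E] [InnerProductSpace ℝ E]

open scoped RealInnerProductSpace

/-- `h` is the sup-convolution of `w` over `S`, attained at `Z`, and `Y` is the proximal map
computing the inf-convolution of `h`. -/
structure IsLasryLions (S : Set E) (w : E → ℝ) (α : ℝ) (h : E → ℝ) (Z Y : E → E) : Prop where
  mem : ∀ y, Z y ∈ S
  h_eq : ∀ y, h y = w (Z y) - 6 * α / 5 * ‖y - Z y‖ ^ 2
  le_h : ∀ y, ∀ z ∈ S, w z - 6 * α / 5 * ‖y - z‖ ^ 2 ≤ h y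
  min : ∀ x y, h (Y x) + 6 * α * ‖x - Y x‖ ^ 2 ≤ h y + 6 * α * ‖x - y‖ ^ 2

theorem sup_convolution_subgradient {S : Set E} {w h : E → ℝ} {Z : E → E} {α : ℝ}
    (mem : ∀ y, Z y ∈ S)
    (h_eq : ∀ y, h y = w (Z y) - 6 * α / 5 * ‖y - Z y‖ ^ 2)
    (le_h : ∀ y, ∀ z ∈ S, w z - 6 * α / 5 * ‖y - z‖ ^ 2 ≤ h y) (y y' : E) :
    h y + ⟪(12 * α / 5) • (Z y - y), y' - y⟫ - 6 * α / 5 * ‖y' - y‖ ^ 2 ≤ h y' := by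
  have h1 := h_eq y
  have h2 := le_h y' (Z y) (mem y)
  rw [h1]
  refine le_trans (le_of_eq ?_) h2
  simp only [← real_inner_self_eq_norm_sq, inner_sub_left, inner_sub_right, inner_smul_left,
    real_inner_comm, conj_trivial]
  ring

theorem exists_isLasryLions [FiniteDimensional ℝ E] {S : Set E} (hS : IsCompact S)
    (hne : S.Nonempty) {w : E → ℝ} (hw : UpperSemicontinuousOn w S) {α : ℝ} (hα : 0 < α) :
    ∃ h Z Y, IsLasryLions S w α h Z Y := by
  have hmax : ∀ y, ∃ z ∈ S, ∀ z' ∈ S,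
      w z' - 6 * α / 5 * ‖y - z'‖ ^ 2 ≤ w z - 6 * α / 5 * ‖y - z‖ ^ 2 := by
    intro y
    have hu : UpperSemicontinuousOn (fun z => w z + -(6 * α / 5 * ‖y - z‖ ^ 2)) S :=
      hw.add (((by fun_prop : Continuous fun z => -(6 * α / 5 * ‖y - z‖ ^ 2)).upperSemicontinuous).upperSemicontinuousOn S)
    obtain ⟨z, hz, hzm⟩ := hu.exists_isMaxOn hne hS
    exact ⟨z, hz, fun z' hz' => by simpa [sub_eq_add_neg] using hzm hz'⟩
  choose Z hZ hZm using hmax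
  set h : E → ℝ := fun y => w (Z y) - 6 * α / 5 * ‖y - Z y‖ ^ 2 with hh
  have hsub := sup_convolution_subgradient (h := h) hZ (fun y => rfl) hZm
  have hlsc : LowerSemicontinuous h := by
    intro y c hc
    have hcont : Continuous fun y' =>
        h y + ⟪(12 * α / 5) • (Z y - y), y' - y⟫ - 6 * α / 5 * ‖y' - y‖ ^ 2 := by fun_prop
    have : c < h y + ⟪(12 * α / 5) • (Z y - y), y - y⟫ - 6 * α / 5 * ‖y - y‖ ^ 2 := by simpa using hc
    filter_upwards [hcont.continuousAt.eventually (lt_mem_nhds this)] with y' hy'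
    exact hy'.trans_le (hsub y y')
  have hmin : ∀ x, ∃ y, ∀ y', h y + 6 * α * ‖x - y‖ ^ 2 ≤ h y' + 6 * α * ‖x - y'‖ ^ 2 := by
    intro x
    have hl : LowerSemicontinuousOn (fun y => h y + 6 * α * ‖x - y‖ ^ 2)
        (Metric.closedBall x ‖Z x - x‖) :=
      (hlsc.add (Continuous.lowerSemicontinuous (by fun_prop))).lowerSemicontinuousOn _
    have hx : x ∈ Metric.closedBall x ‖Z x - x‖ := Metric.mem_closedBall_self (norm_nonneg _)
    obtain ⟨y, hy, hym⟩ := hl.exists_isMinOn ⟨x, hx⟩ (isCompact_closedBall _ _)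
    refine ⟨y, fun y' => ?_⟩
    by_cases hy' : y' ∈ Metric.closedBall x ‖Z x - x‖
    · exact hym hy'
    · have h1 : h y + 6 * α * ‖x - y‖ ^ 2 ≤ h x + 6 * α * ‖x - x‖ ^ 2 := hym hx
      have h2 := hsub x y'
      have h3 : ‖Z x - x‖ < ‖y' - x‖ := by simpa [dist_eq_norm] using hy'
      have h4 : -(‖Z x - x‖ * ‖y' - x‖) ≤ ⟪Z x - x, y' - x⟫ :=
        (abs_le.1 (abs_real_inner_le_norm _ _)).1
      rw [inner_smul_left, conj_trivial] at h2
      rw [norm_sub_rev x y']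
      simp only [sub_self, norm_zero] at h1
      have h5 : ‖Z x - x‖ * ‖y' - x‖ ≤ ‖y' - x‖ ^ 2 := by nlinarith [norm_nonneg (y' - x)]
      nlinarith [mul_le_mul_of_nonneg_left h5 hα.le, mul_le_mul_of_nonneg_left h4 hα.le,
        mul_nonneg hα.le (sq_nonneg ‖y' - x‖)]
  choose Y hY using hmin
  exact ⟨h, Z, Y, hZ, fun y => rfl, hZm, hY⟩

namespace IsLasryLions

variable {S : Set E} {w h : E → ℝ} {Z Y : E → E} {α : ℝ}

theorem subgradient (H : IsLasryLions S w α h Z Y) (y y' : E) :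
    h y + ⟪(12 * α / 5) • (Z y - y), y' - y⟫ - 6 * α / 5 * ‖y' - y‖ ^ 2 ≤ h y' :=
  sup_convolution_subgradient H.mem H.h_eq H.le_h y y'

theorem prox_subgradient (H : IsLasryLions S w α h Z Y) (x y' : E) :
    h (Y x) + ⟪(12 * α) • (x - Y x), y' - Y x⟫ - 6 * α / 5 * ‖y' - Y x‖ ^ 2 ≤ h y' := by
  have key : ∀ t ∈ Set.Ioo (0 : ℝ) 1,
      h (Y x) + ⟪(12 * α) • (x - Y x), y' - Y x⟫ - 6 * α / 5 * (1 - t) * ‖y' - Y x‖ ^ 2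
        - 6 * α * t * ‖y' - Y x‖ ^ 2 ≤ h y' := by
    intro t ht
    obtain ⟨d, rfl⟩ : ∃ d, y' = Y x + d := ⟨y' - Y x, by abel⟩
    set y := Y x
    have h1 := H.min x (y + t • d)
    have h2 := H.h_eq (y + t • d)
    have h3 := H.le_h y _ (H.mem (y + t • d))
    have h4 := H.le_h (y + d) _ (H.mem (y + t • d))
    set z := Z (y + t • d)
    rw [h2] at h1
    have h5 := mul_le_mul_of_nonneg_left h3 (sub_nonneg.2 ht.2.le)
    have h6 := mul_le_mul_of_nonneg_left h4 ht.1.le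
    have h7 : t * (h y + ⟪(12 * α) • (x - y), y + d - y⟫
        - 6 * α / 5 * (1 - t) * ‖y + d - y‖ ^ 2 - 6 * α * t * ‖y + d - y‖ ^ 2) ≤ t * h (y + d) := by
      rw [add_sub_cancel_left]
      simp only [← real_inner_self_eq_norm_sq, inner_sub_left, inner_sub_right, inner_smul_left,
        inner_smul_right, inner_add_left, inner_add_right, real_inner_comm, conj_trivial]
        at h1 h5 h6 ⊢
      linarith
    exact le_of_mul_le_mul_left h7 ht.1
  have hcont : Continuous fun t : ℝ => h (Y x) + ⟪(12 * α) • (x - Y x), y' - Y x⟫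
      - 6 * α / 5 * (1 - t) * ‖y' - Y x‖ ^ 2 - 6 * α * t * ‖y' - Y x‖ ^ 2 := by fun_prop
  have hlim := (hcont.tendsto 0).mono_left (nhdsWithin_le_nhds (s := Set.Ioi 0))
  refine le_of_tendsto (by simpa using hlim) ?_
  filter_upwards [Ioo_mem_nhdsGT (zero_lt_one (α := ℝ))] with t ht using key t ht

theorem prox_eq (H : IsLasryLions S w α h Z Y) (hα : 0 < α) {x y q : E}
    (hx : (12 * α) • (x - y) = q)
    (hq : ∀ y', h y + ⟪q, y' - y⟫ - 6 * α / 5 * ‖y' - y‖ ^ 2 ≤ h y') : Y x = y := by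
  have h1 := hq (Y x)
  have h2 := H.min x y
  subst hx
  have h3 : (6 * α - 6 * α / 5) * ‖Y x - y‖ ^ 2 ≤ 0 := by
    simp only [← real_inner_self_eq_norm_sq, inner_sub_left, inner_sub_right, inner_smul_left,
        inner_smul_right, inner_add_left, inner_add_right, real_inner_comm, conj_trivial]
        at h1 h2 ⊢
    linarith
  have h4 : ‖Y x - y‖ ^ 2 ≤ 0 := by nlinarith [sq_nonneg ‖Y x - y‖]
  exact sub_eq_zero.1 (norm_eq_zero.1 (by nlinarith [norm_nonneg (Y x - y)]))

theorem norm_prox_sub_le (H : IsLasryLions S w α h Z Y) (hα : 0 < α) (x x' : E) :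
    ‖Y x - Y x'‖ ≤ 5 / 4 * ‖x - x'‖ := by
  have h1 := H.prox_subgradient x (Y x')
  have h2 := H.prox_subgradient x' (Y x)
  have h3 : α * ‖Y x - Y x'‖ ^ 2 ≤ α * (5 / 4 * ⟪x - x', Y x - Y x'⟫) := by
    simp only [← real_inner_self_eq_norm_sq, inner_sub_left, inner_sub_right, inner_smul_left,
        inner_smul_right, inner_add_left, inner_add_right, real_inner_comm, conj_trivial]
        at h1 h2 ⊢
    linarith
  have h4 := le_of_mul_le_mul_left h3 hα
  have h5 := real_inner_le_norm (x - x') (Y x - Y x')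
  by_contra! hlt
  have : 0 < ‖Y x - Y x'‖ := lt_of_le_of_lt (by positivity) hlt
  nlinarith

theorem lipschitz (H : IsLasryLions S w α h Z Y) (hα : 0 < α) :
    LipschitzWith (Real.toNNReal (27 * α)) fun x => (12 * α) • (x - Y x) := by
  refine LipschitzWith.of_dist_le_mul fun x x' => ?_
  rw [Real.coe_toNNReal _ (by positivity), dist_eq_norm, dist_eq_norm, ← smul_sub, norm_smul,
    Real.norm_of_nonneg (by positivity)]
  have h1 := H.norm_prox_sub_le hα x x'
  have h2 : ‖x - Y x - (x' - Y x')‖ ≤ ‖x - x'‖ + ‖Y x - Y x'‖ := by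
    rw [sub_sub_sub_comm]; exact norm_sub_le _ _
  nlinarith

theorem abs_sub_le (H : IsLasryLions S w α h Z Y) (hα : 0 < α) (x k : E) :
    |(h (Y (x + k)) + 6 * α * ‖x + k - Y (x + k)‖ ^ 2) - (h (Y x) + 6 * α * ‖x - Y x‖ ^ 2)
      - ⟪(12 * α) • (x - Y x), k⟫| ≤ 33 * α * ‖k‖ ^ 2 := by
  have h1 := H.min (x + k) (Y x)
  have h2 := H.min x (Y (x + k))
  have h3 := H.norm_prox_sub_le hα x (x + k)
  rw [sub_add_cancel_left, norm_neg] at h3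
  have h4 := real_inner_le_norm (Y x - Y (x + k)) (-k)
  have h6 : ‖Y x - Y (x + k)‖ * ‖-k‖ ≤ 5 / 4 * ‖k‖ ^ 2 := by
    rw [norm_neg]; nlinarith [norm_nonneg k]
  have h5 := mul_le_mul_of_nonneg_left (h4.trans h6) hα.le
  have h7 := mul_nonneg hα.le (sq_nonneg ‖k‖)
  simp only [← real_inner_self_eq_norm_sq, inner_sub_left, inner_sub_right, inner_smul_left,
        inner_smul_right, inner_add_left, inner_add_right, real_inner_comm, conj_trivial,
        inner_neg_right]
        at h1 h2 h5 h7 ⊢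
  rw [abs_le]
  constructor <;> linarith

theorem hasGradientAt [CompleteSpace E] (H : IsLasryLions S w α h Z Y) (hα : 0 < α) (x : E) :
    HasGradientAt (fun x => h (Y x) + 6 * α * ‖x - Y x‖ ^ 2) ((12 * α) • (x - Y x)) x := by
  rw [hasGradientAt_iff_hasFDerivAt, hasFDerivAt_iff_isLittleO_nhds_zero]
  refine Asymptotics.IsBigO.trans_isLittleO (g := fun k : E => ‖k‖ ^ 2) ?_ ?_
  · refine Asymptotics.IsBigO.of_bound (33 * α) (Eventually.of_forall fun k => ?_)
    rw [Real.norm_eq_abs, Real.norm_of_nonneg (by positivity)]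
    simpa only [InnerProductSpace.toDual_apply_apply] using H.abs_sub_le hα x k
  · simpa using (Asymptotics.isLittleO_norm_pow_id (E' := E) one_lt_two)

theorem le_inf_convolution (H : IsLasryLions S w α h Z Y) (hα : 0 < α) (x : E) {z : E}
    (hz : z ∈ S) : w z - 3 * α / 2 * ‖x - z‖ ^ 2 ≤ h (Y x) + 6 * α * ‖x - Y x‖ ^ 2 := by
  have h1 := H.le_h (Y x) z hz
  have h2 : 0 ≤ α * ‖(5 : ℝ) • (x - Y x) + (Y x - z)‖ ^ 2 := by positivity
  simp only [← real_inner_self_eq_norm_sq, inner_sub_left, inner_sub_right, inner_smul_left,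
        inner_smul_right, inner_add_left, inner_add_right, real_inner_comm, conj_trivial]
        at h1 h2 ⊢
  linarith

theorem contact (H : IsLasryLions S w α h Z Y) (hα : 0 < α) {x : E} {P : E →L[ℝ] E}
    (hP : HasFDerivAt (fun x => (12 * α) • (x - Y x)) P x)
    (hlt : ∀ e, e ≠ 0 → ⟪P e, e⟫ < 12 * α * ‖e‖ ^ 2) :
    ∃ z ∈ S, (12 * α) • (x - Y x) = (3 * α) • (z - x) ∧
      h (Y x) + 6 * α * ‖x - Y x‖ ^ 2 = w z - 3 * α / 2 * ‖x - z‖ ^ 2 := by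
  set p := (12 * α) • (x - Y x) with hp
  set q := (12 * α / 5) • (Z (Y x) - Y x) with hq
  have hα0 : (12 * α) ≠ 0 := by positivity
  have hseg : ∀ t ∈ Set.Icc (0 : ℝ) 1,
      (12 * α) • (x + t • ((12 * α)⁻¹ • (q - p)) - Y (x + t • ((12 * α)⁻¹ • (q - p))))
        = p + t • (q - p) := by
    intro t ht
    have hpt : (12 * α) • (x + t • ((12 * α)⁻¹ • (q - p)) - Y x) = p + t • (q - p) := by
      rw [add_sub_right_comm, smul_add, ← hp, smul_comm t, smul_smul, mul_inv_cancel₀ hα0, one_smul]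
    rw [H.prox_eq hα hpt, hpt]
    intro y'
    have h1 := mul_le_mul_of_nonneg_left (H.subgradient (Y x) y') ht.1
    have h2 := mul_le_mul_of_nonneg_left (H.prox_subgradient x y') (sub_nonneg.2 ht.2)
    rw [← hq] at h1
    rw [← hp] at h2
    simp only [inner_add_left, inner_smul_left, inner_sub_left, conj_trivial] at h1 h2 ⊢
    linarith
  have hqp : q - p = 0 := by
    by_contra hne
    set e := (12 * α)⁻¹ • (q - p) with he
    have hene : e ≠ 0 := smul_ne_zero (inv_ne_zero hα0) hne
    have hqe : q - p = (12 * α) • e := by rw [he, smul_smul, mul_inv_cancel₀ hα0, one_smul]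
    have hline : HasDerivAt (fun t : ℝ => x + t • e) e 0 := by
      simpa using ((hasDerivAt_id (0 : ℝ)).smul_const e).const_add x
    have h1 : HasDerivAt (fun t : ℝ => (12 * α) • (x + t • e - Y (x + t • e))) (P e) 0 := by
      refine HasFDerivAt.comp_hasDerivAt (l := fun x => (12 * α) • (x - Y x)) (0 : ℝ)
        (f := fun t : ℝ => x + t • e) ?_ hline
      simpa using hP
    have h2 : HasDerivAt (fun t : ℝ => p + t • (q - p)) (q - p) 0 := by
      simpa using ((hasDerivAt_id (0 : ℝ)).smul_const (q - p)).const_add p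
    have h3 : HasDerivWithinAt (fun t : ℝ => p + t • (q - p)) (P e) (Set.Icc 0 1) 0 :=
      h1.hasDerivWithinAt.congr (fun t ht => (hseg t ht).symm)
        (hseg 0 ⟨le_rfl, zero_le_one⟩).symm
    have h4 : P e = q - p :=
      UniqueDiffWithinAt.eq_deriv (Set.Icc (0 : ℝ) 1)
      (uniqueDiffOn_Icc zero_lt_one 0 ⟨le_rfl, zero_le_one⟩) h3 h2.hasDerivWithinAt
    have h5 := hlt e hene
    rw [h4, hqe, inner_smul_left, real_inner_self_eq_norm_sq, conj_trivial] at h5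
    exact lt_irrefl _ h5
  have hqp' := sub_eq_zero.1 hqp
  have hzy : Z (Y x) - Y x = (5 : ℝ) • (x - Y x) := by
    have : (12 * α / 5) • (Z (Y x) - Y x) = (12 * α / 5) • ((5 : ℝ) • (x - Y x)) := by
      rw [smul_smul, ← hq, hqp', hp]; congr 1; ring
    exact smul_right_injective E (by positivity : (12 * α / 5) ≠ 0) this
  have hz : Z (Y x) = Y x + (5 : ℝ) • (x - Y x) := by rw [← hzy]; abel
  refine ⟨Z (Y x), H.mem _, ?_, ?_⟩
  · rw [hz, hp, show Y x + (5 : ℝ) • (x - Y x) - x = (4 : ℝ) • (x - Y x) by module, smul_smul]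
    congr 1; ring
  · rw [H.h_eq, hz]
    simp only [show Y x - (Y x + (5 : ℝ) • (x - Y x)) = (-5 : ℝ) • (x - Y x) by module,
      show x - (Y x + (5 : ℝ) • (x - Y x)) = (-4 : ℝ) • (x - Y x) by module, norm_smul, mul_pow]
    norm_num
    ring

end IsLasryLions

end Regularization

section Jensen

open scoped RealInnerProductSpace

theorem LipschitzWith.exists_differentiableAt_of_isOpen_subset_image {V : Type*}
    [NormedAddCommGroup V] [NormedSpace ℝ V] [FiniteDimensional ℝ V] {T : V → V} {L : NNReal}
    (hT : LipschitzWith L T) {U K : Set V} (hU : IsOpen U) (hne : U.Nonempty)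
    (hUK : U ⊆ T '' K) : ∃ ξ ∈ K, DifferentiableAt ℝ T ξ := by
  by_contra! hK
  borelize V
  set μ : MeasureTheory.Measure V :=
    MeasureTheory.Measure.hausdorffMeasure (Module.finrank ℝ V : ℝ) with hμ
  have : μ.IsAddHaarMeasure := MeasureTheory.isAddHaarMeasure_hausdorffMeasure
  have h1 : μ K = 0 :=
    MeasureTheory.measure_mono_null hK (MeasureTheory.ae_iff.1 (hT.ae_differentiableAt (μ := μ)))
  have h2 := hT.hausdorffMeasure_image_le (d := (Module.finrank ℝ V : ℝ)) (Nat.cast_nonneg _) K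
  rw [← hμ, h1, mul_zero] at h2
  exact (hU.measure_pos μ hne).not_ge ((MeasureTheory.measure_mono hUK).trans h2)

variable {E : Type*} [NormedAddCommGroup E] [InnerProductSpace ℝ E]

theorem HasGradientAt.hasDerivAt_line [CompleteSpace E] {g : E → ℝ} {v x k : E} {t : ℝ}
    (hg : HasGradientAt g v (x + t • k)) : HasDerivAt (fun s : ℝ => g (x + s • k)) ⟪v, k⟫ t := by
  have hline : HasDerivAt (fun s : ℝ => x + s • k) k t := by
    simpa using ((hasDerivAt_id t).smul_const k).const_add x
  have h := HasFDerivAt.comp_hasDerivAt (f := fun s : ℝ => x + s • k) t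
    (hasGradientAt_iff_hasFDerivAt.1 hg) hline
  rwa [InnerProductSpace.toDual_apply_apply] at h

theorem HasGradientAt.eq_of_forall_sub_le [CompleteSpace E] {g : E → ℝ} {p v x : E} {C : ℝ}
    (hg : HasGradientAt g p x) (h : ∀ k, g (x + k) ≤ g x + ⟪v, k⟫ + C * ‖k‖ ^ 2) : p = v := by
  set e := p - v with he
  have h1 : HasDerivAt (fun t : ℝ => g (x + t • e) - (t * ⟪v, e⟫ + t ^ 2 * (C * ‖e‖ ^ 2)))
      (⟪p, e⟫ - ⟪v, e⟫) 0 := by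
    have h0 : HasGradientAt g p (x + (0 : ℝ) • e) := by simpa using hg
    have h2 : HasDerivAt (fun t : ℝ => t * ⟪v, e⟫ + t ^ 2 * (C * ‖e‖ ^ 2)) ⟪v, e⟫ 0 := by
      have := ((hasDerivAt_id (0 : ℝ)).mul_const ⟪v, e⟫).add
        ((hasDerivAt_pow 2 (0 : ℝ)).mul_const (C * ‖e‖ ^ 2))
      refine this.congr_deriv ?_
      simp
    exact h0.hasDerivAt_line.sub h2
  have h2 : IsLocalMax (fun t : ℝ => g (x + t • e) - (t * ⟪v, e⟫ + t ^ 2 * (C * ‖e‖ ^ 2))) 0 := by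
    refine Eventually.of_forall fun t => ?_
    have := h (t • e)
    rw [inner_smul_right, norm_smul, mul_pow, Real.norm_eq_abs, sq_abs] at this
    simp only [zero_smul, add_zero]
    linarith
  have h3 := h2.hasDerivAt_eq_zero h1
  rw [← inner_sub_left, ← he, inner_self_eq_zero] at h3
  exact sub_eq_zero.1 h3

theorem eventually_abs_taylor_le [CompleteSpace E] {g : E → ℝ} {p : E → E}
    (hg : ∀ x, HasGradientAt g (p x) x) {x : E} {P : E →L[ℝ] E} (hP : HasFDerivAt p P x)
    {ε : ℝ} (hε : 0 < ε) :
    ∀ᶠ k in 𝓝 (0 : E), |g (x + k) - g x - ⟪p x, k⟫ - 1 / 2 * ⟪P k, k⟫| ≤ ε * ‖k‖ ^ 2 := by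
  have h1 := (hasFDerivAt_iff_isLittleO_nhds_zero.1 hP).def hε
  obtain ⟨r, hr, hball⟩ := Metric.eventually_nhds_iff_ball.1 h1
  filter_upwards [Metric.ball_mem_nhds (0 : E) hr] with k hk
  have hder : ∀ t ∈ Set.Icc (0 : ℝ) 1, HasDerivWithinAt
      (fun t : ℝ => g (x + t • k) - (t * ⟪p x, k⟫ + t ^ 2 * (1 / 2 * ⟪P k, k⟫)))
      (⟪p (x + t • k), k⟫ - (⟪p x, k⟫ + t * ⟪P k, k⟫)) (Set.Icc 0 1) t := by
    intro t _
    have h2 : HasDerivAt (fun t : ℝ => t * ⟪p x, k⟫ + t ^ 2 * (1 / 2 * ⟪P k, k⟫))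
        (⟪p x, k⟫ + t * ⟪P k, k⟫) t := by
      have := ((hasDerivAt_id t).mul_const ⟪p x, k⟫).add
        ((hasDerivAt_pow 2 t).mul_const (1 / 2 * ⟪P k, k⟫))
      refine this.congr_deriv ?_
      simp
      ring
    exact ((hg _).hasDerivAt_line.sub h2).hasDerivWithinAt
  have hbound : ∀ t ∈ Set.Ico (0 : ℝ) 1,
      ‖⟪p (x + t • k), k⟫ - (⟪p x, k⟫ + t * ⟪P k, k⟫)‖ ≤ ε * ‖k‖ ^ 2 := by
    intro t ht
    have htk : ‖t • k‖ ≤ ‖k‖ := by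
      rw [norm_smul, Real.norm_of_nonneg ht.1]
      exact mul_le_of_le_one_left (norm_nonneg _) ht.2.le
    have h3 := hball (t • k) (by
      rw [mem_ball_zero_iff] at hk ⊢; exact htk.trans_lt hk)
    have h4 : ⟪p (x + t • k), k⟫ - (⟪p x, k⟫ + t * ⟪P k, k⟫)
        = ⟪p (x + t • k) - p x - P (t • k), k⟫ := by
      rw [map_smul, inner_sub_left, inner_sub_left, inner_smul_left, conj_trivial]; ring
    rw [h4]
    refine (norm_inner_le_norm _ _).trans ?_
    nlinarith [norm_nonneg k, mul_le_mul_of_nonneg_left htk hε.le]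
  have := norm_image_sub_le_of_norm_deriv_le_segment_01' hder hbound
  rw [Real.norm_eq_abs] at this
  convert this using 2
  simp
  ring

theorem quadratic_le_of_eventually_le {P₁ P₂ : E →L[ℝ] E} {β δ : ℝ}
    (h : ∀ ε > 0, ∀ᶠ k : E × E in 𝓝 0, ⟪P₁ k.1, k.1⟫ + ⟪P₂ k.2, k.2⟫
      ≤ β * ‖k.1 - k.2‖ ^ 2 + δ * (‖k.1‖ ^ 2 + ‖k.2‖ ^ 2) + ε * (‖k.1‖ ^ 2 + ‖k.2‖ ^ 2))
    (k₁ k₂ : E) : ⟪P₁ k₁, k₁⟫ + ⟪P₂ k₂, k₂⟫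
      ≤ β * ‖k₁ - k₂‖ ^ 2 + δ * (‖k₁‖ ^ 2 + ‖k₂‖ ^ 2) := by
  have key : ∀ ε > 0, ⟪P₁ k₁, k₁⟫ + ⟪P₂ k₂, k₂⟫
      ≤ β * ‖k₁ - k₂‖ ^ 2 + δ * (‖k₁‖ ^ 2 + ‖k₂‖ ^ 2) + ε * (‖k₁‖ ^ 2 + ‖k₂‖ ^ 2) := by
    intro ε hε
    have hc : Tendsto (fun t : ℝ => (t • k₁, t • k₂)) (𝓝[>] 0) (𝓝 (0 : E × E)) := by
      have : Continuous fun t : ℝ => (t • k₁, t • k₂) := by fun_prop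
      exact (this.tendsto' 0 0 (by simp)).mono_left nhdsWithin_le_nhds
    obtain ⟨t, ht, ht0⟩ := ((hc.eventually (h ε hε)).and self_mem_nhdsWithin).exists
    have ht0 : 0 < t := ht0
    simp only [map_smul, ← smul_sub, norm_smul, inner_smul_left, inner_smul_right, mul_pow,
      Real.norm_eq_abs, sq_abs, conj_trivial] at ht
    have : 0 < t ^ 2 := by positivity
    refine le_of_mul_le_mul_left ?_ this
    linarith
  have hc : Continuous fun ε : ℝ =>
      β * ‖k₁ - k₂‖ ^ 2 + δ * (‖k₁‖ ^ 2 + ‖k₂‖ ^ 2) + ε * (‖k₁‖ ^ 2 + ‖k₂‖ ^ 2) := by fun_prop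
  have hlim := (hc.tendsto 0).mono_left (nhdsWithin_le_nhds (s := Set.Ioi 0))
  refine ge_of_tendsto (by simpa using hlim) ?_
  filter_upwards [self_mem_nhdsWithin] with ε hε using key ε hε

/-- Jensen's maximum principle for a sum of two `C^{1,1}` functions. -/
theorem exists_second_order_max [FiniteDimensional ℝ E] {g₁ g₂ : E → ℝ} {p₁ p₂ : E → E}
    (hg₁ : ∀ x, HasGradientAt g₁ (p₁ x) x) (hg₂ : ∀ x, HasGradientAt g₂ (p₂ x) x)
    {L₁ L₂ : NNReal} (hL₁ : LipschitzWith L₁ p₁) (hL₂ : LipschitzWith L₂ p₂) {a b : E} {β : ℝ}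
    (hle : ∀ x₁ x₂, g₁ x₁ + g₂ x₂ ≤ g₁ a + g₂ b + β / 2 * ‖(x₁ - a) - (x₂ - b)‖ ^ 2)
    {δ : ℝ} (hδ : 0 < δ) :
    ∃ (x₁ x₂ : E) (P₁ P₂ : E →L[ℝ] E), ‖x₁ - a‖ ≤ δ ∧ ‖x₂ - b‖ ≤ δ ∧ HasFDerivAt p₁ P₁ x₁ ∧ HasFDerivAt p₂ P₂ x₂ ∧
      ∀ k₁ k₂, ⟪P₁ k₁, k₁⟫ + ⟪P₂ k₂, k₂⟫
        ≤ β * ‖k₁ - k₂‖ ^ 2 + δ * (‖k₁‖ ^ 2 + ‖k₂‖ ^ 2) := by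
  set T : E × E → E × E := fun ξ =>
    (p₁ ξ.1 - (β • (ξ.1 - ξ.2) + δ • ξ.1), p₂ ξ.2 - (-β • (ξ.1 - ξ.2) + δ • ξ.2)) with hT
  set A : E × E →L[ℝ] E × E :=
    (β • (ContinuousLinearMap.fst ℝ E E - ContinuousLinearMap.snd ℝ E E)
      + δ • ContinuousLinearMap.fst ℝ E E).prod
    (-β • (ContinuousLinearMap.fst ℝ E E - ContinuousLinearMap.snd ℝ E E)
      + δ • ContinuousLinearMap.snd ℝ E E) with hA
  have hTA : ∀ ξ, T ξ = (p₁ ξ.1, p₂ ξ.2) - A ξ := fun ξ => by simp [hT, hA]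
  obtain ⟨L, hL⟩ : ∃ L, LipschitzWith L T := by
    have := ((hL₁.comp LipschitzWith.prod_fst).prodMk (hL₂.comp LipschitzWith.prod_snd)).sub
      A.lipschitz
    rw [show T = fun ξ => (p₁ ξ.1, p₂ ξ.2) - A ξ from funext hTA]
    exact ⟨_, this⟩
  set K : Set (E × E) := {ξ | ‖ξ.1 - a‖ ≤ δ ∧ ‖ξ.2 - b‖ ≤ δ ∧ ∀ k₁ k₂,
    g₁ (ξ.1 + k₁) + g₂ (ξ.2 + k₂) ≤ g₁ ξ.1 + g₂ ξ.2 + ⟪p₁ ξ.1, k₁⟫ + ⟪p₂ ξ.2, k₂⟫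
      + β / 2 * ‖k₁ - k₂‖ ^ 2 + δ / 2 * (‖k₁‖ ^ 2 + ‖k₂‖ ^ 2)} with hK
  have hsub : Metric.ball (- A (a, b)) (δ ^ 2 / 4) ⊆ T '' K := by
    intro q' hq'
    obtain ⟨⟨q₁, q₂⟩, rfl⟩ : ∃ q : E × E, q' = q - A (a, b) := ⟨q' + A (a, b), by abel⟩
    rw [Metric.mem_ball, dist_eq_norm, sub_neg_eq_add, sub_add_cancel] at hq'
    have hq₁ : ‖q₁‖ < δ ^ 2 / 4 := (norm_fst_le (q₁, q₂)).trans_lt hq'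
    have hq₂ : ‖q₂‖ < δ ^ 2 / 4 := (norm_snd_le (q₁, q₂)).trans_lt hq'
    set Ψ : E × E → ℝ := fun ξ => g₁ ξ.1 + g₂ ξ.2 - β / 2 * ‖(ξ.1 - a) - (ξ.2 - b)‖ ^ 2
      - δ / 2 * (‖ξ.1 - a‖ ^ 2 + ‖ξ.2 - b‖ ^ 2) - ⟪q₁, ξ.1 - a⟫ - ⟪q₂, ξ.2 - b⟫ with hΨ
    have hc₁ : Continuous g₁ := continuous_iff_continuousAt.2 fun x => (hg₁ x).continuousAt
    have hc₂ : Continuous g₂ := continuous_iff_continuousAt.2 fun x => (hg₂ x).continuousAt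
    have hΨc : Continuous Ψ := by fun_prop
    have hmem : (a, b) ∈ Metric.closedBall (a, b) δ := Metric.mem_closedBall_self hδ.le
    obtain ⟨ξ, hξ, hξm⟩ := (isCompact_closedBall (a, b) δ).exists_isMaxOn ⟨_, hmem⟩
      hΨc.continuousOn
    have hglob : ∀ η, Ψ η ≤ Ψ ξ := by
      intro η
      by_cases hη : η ∈ Metric.closedBall (a, b) δ
      · exact hξm hη
      · have h0 : Ψ (a, b) ≤ Ψ ξ := hξm hmem
        refine le_trans ?_ h0
        have h1 := hle η.1 η.2
        have h2 := (abs_le.1 (abs_real_inner_le_norm q₁ (η.1 - a))).1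
        have h3 := (abs_le.1 (abs_real_inner_le_norm q₂ (η.2 - b))).1
        rw [Metric.mem_closedBall, dist_eq_norm, not_le, Prod.norm_def, lt_max_iff] at hη
        have h4 := norm_nonneg (η.1 - a)
        have h5 := norm_nonneg (η.2 - b)
        have h6 := mul_le_mul_of_nonneg_right hq₁.le h4
        have h7 := mul_le_mul_of_nonneg_right hq₂.le h5
        have h8 : δ * (‖η.1 - a‖ + ‖η.2 - b‖) ≤ 2 * (‖η.1 - a‖ ^ 2 + ‖η.2 - b‖ ^ 2) := by
          simp only [Prod.fst_sub, Prod.snd_sub] at hη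
          rcases hη with hη | hη
          · nlinarith [sq_nonneg (‖η.1 - a‖ - ‖η.2 - b‖)]
          · nlinarith [sq_nonneg (‖η.1 - a‖ - ‖η.2 - b‖)]
        have h9 := mul_le_mul_of_nonneg_left h8 hδ.le
        simp only [hΨ, sub_self, norm_zero, inner_zero_right]
        nlinarith
    have hquad : ∀ k₁ k₂, g₁ (ξ.1 + k₁) + g₂ (ξ.2 + k₂) ≤ g₁ ξ.1 + g₂ ξ.2
        + ⟪β • ((ξ.1 - a) - (ξ.2 - b)) + δ • (ξ.1 - a) + q₁, k₁⟫
        + ⟪-β • ((ξ.1 - a) - (ξ.2 - b)) + δ • (ξ.2 - b) + q₂, k₂⟫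
        + β / 2 * ‖k₁ - k₂‖ ^ 2 + δ / 2 * (‖k₁‖ ^ 2 + ‖k₂‖ ^ 2) := by
      intro k₁ k₂
      have h1 := hglob (ξ.1 + k₁, ξ.2 + k₂)
      simp only [hΨ, add_sub_right_comm _ _ a, add_sub_right_comm _ _ b] at h1
      generalize ξ.1 - a = c at h1 ⊢
      generalize ξ.2 - b = e at h1 ⊢
      simp only [← real_inner_self_eq_norm_sq, inner_sub_left, inner_sub_right, inner_smul_left,
        inner_add_left, inner_add_right, real_inner_comm, conj_trivial] at h1 ⊢
      linarith
    have hp₁ : p₁ ξ.1 = β • ((ξ.1 - a) - (ξ.2 - b)) + δ • (ξ.1 - a) + q₁ := by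
      refine (hg₁ ξ.1).eq_of_forall_sub_le (C := β / 2 + δ / 2) fun k => ?_
      have := hquad k 0
      simp only [add_zero, inner_zero_right, sub_zero, norm_zero] at this
      linarith
    have hp₂ : p₂ ξ.2 = -β • ((ξ.1 - a) - (ξ.2 - b)) + δ • (ξ.2 - b) + q₂ := by
      refine (hg₂ ξ.2).eq_of_forall_sub_le (C := β / 2 + δ / 2) fun k => ?_
      have := hquad 0 k
      simp only [add_zero, inner_zero_right, zero_sub, norm_zero, norm_neg] at this
      linarith
    rw [Metric.mem_closedBall, dist_eq_norm] at hξ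
    refine ⟨ξ, ⟨(norm_fst_le (ξ - (a, b))).trans hξ, (norm_snd_le (ξ - (a, b))).trans hξ, ?_⟩, ?_⟩
    · rw [hp₁, hp₂]; exact hquad
    · simp only [hT, hA, hp₁, hp₂]
      ext1 <;> simp <;> module
  obtain ⟨ξ, ⟨hξ₁, hξ₂, hξ⟩, hd⟩ := hL.exists_differentiableAt_of_isOpen_subset_image
    Metric.isOpen_ball (Metric.nonempty_ball.2 (by positivity)) hsub
  have hd' : DifferentiableAt ℝ (fun η : E × E => (p₁ η.1, p₂ η.2)) ξ := by
    have := hd.add A.differentiableAt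
    refine this.congr_of_eventuallyEq (Eventually.of_forall fun η => ?_)
    simp [hTA]
  have hd₁ : DifferentiableAt ℝ p₁ ξ.1 := by
    have : DifferentiableAt ℝ (fun x : E => (x, ξ.2)) ξ.1 := by fun_prop
    exact (DifferentiableAt.comp (g := fun η : E × E => (p₁ η.1, p₂ η.2)) ξ.1 hd' this).fst
  have hd₂ : DifferentiableAt ℝ p₂ ξ.2 := by
    have : DifferentiableAt ℝ (fun x : E => (ξ.1, x)) ξ.2 := by fun_prop
    exact (DifferentiableAt.comp (g := fun η : E × E => (p₁ η.1, p₂ η.2)) ξ.2 hd' this).snd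
  refine ⟨ξ.1, ξ.2, _, _, hξ₁, hξ₂, hd₁.hasFDerivAt, hd₂.hasFDerivAt,
    quadratic_le_of_eventually_le fun ε hε => ?_⟩
  have e₁ := eventually_abs_taylor_le hg₁ hd₁.hasFDerivAt (half_pos hε)
  have e₂ := eventually_abs_taylor_le hg₂ hd₂.hasFDerivAt (half_pos hε)
  filter_upwards [(continuous_fst.tendsto' (0 : E × E) 0 rfl).eventually e₁,
    (continuous_snd.tendsto' (0 : E × E) 0 rfl).eventually e₂] with k h₁ h₂
  have h₃ := hξ k.1 k.2
  linarith [(abs_le.1 h₁).1, (abs_le.1 h₂).1]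

end Jensen

section TheoremOnSums

open scoped RealInnerProductSpace

set_option linter.unusedSimpArgs false

variable {E : Type*} [NormedAddCommGroup E] [InnerProductSpace ℝ E]

namespace IsLasryLions

theorem exists_jet [CompleteSpace E] {S : Set E} {w h : E → ℝ} {Z Y : E → E} {α : ℝ}
    (H : IsLasryLions S w α h Z Y) (hα : 0 < α) {x : E} {P : E →L[ℝ] E}
    (hP : HasFDerivAt (fun x => (12 * α) • (x - Y x)) P x)
    (hlt : ∀ e, e ≠ 0 → ⟪P e, e⟫ < 12 * α * ‖e‖ ^ 2) :
    ∃ z ∈ S, z = x + (3 * α)⁻¹ • ((12 * α) • (x - Y x)) ∧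
      w z = h (Y x) + 6 * α * ‖x - Y x‖ ^ 2 + 3 * α / 2 * ‖x - z‖ ^ 2 ∧
      (∀ η > 0, ∀ᶠ k in 𝓝 0, z + k ∈ S →
        w (z + k) ≤ w z + ⟪(12 * α) • (x - Y x), k⟫ + 1 / 2 * ⟪P k, k⟫ + η * ‖k‖ ^ 2) ∧
      ∀ k, -(3 * α) * ‖k‖ ^ 2 ≤ ⟪P k, k⟫ := by
  obtain ⟨z, hz, hpz, hg⟩ := H.contact hα hP hlt
  have hT := fun η hη => eventually_abs_taylor_le (H.hasGradientAt hα) hP (ε := η) hη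
  refine ⟨z, hz, ?_, by linarith, ?_, ?_⟩
  · rw [hpz, smul_smul, inv_mul_cancel₀ (by positivity), one_smul]; abel
  · intro η hη
    filter_upwards [hT η hη] with k hk hzk
    have h1 := H.le_inf_convolution hα (x + k) hzk
    rw [add_sub_add_right_eq_sub] at h1
    linarith [(abs_le.1 hk).2]
  · have key : ∀ k : E, ⟪(-P) k, k⟫ + ⟪(0 : E →L[ℝ] E) 0, 0⟫
        ≤ 0 * ‖k - 0‖ ^ 2 + 3 * α * (‖k‖ ^ 2 + ‖(0 : E)‖ ^ 2) := by
      intro k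
      refine quadratic_le_of_eventually_le (fun η hη => ?_) k 0
      filter_upwards [(continuous_fst.tendsto' (0 : E × E) 0 rfl).eventually
        (hT (η / 2) (half_pos hη))] with k hk
      have h1 := H.le_inf_convolution hα (x + k.1) hz
      have h2 := (abs_le.1 hk).2
      have h3 : ‖x + k.1 - z‖ ^ 2 = ‖x - z‖ ^ 2 - 2 * ⟪z - x, k.1⟫ + ‖k.1‖ ^ 2 := by
        rw [add_sub_right_comm, norm_add_sq_real, ← neg_sub z x, inner_neg_left, norm_neg]; ring
      rw [h3] at h1
      rw [hpz, inner_smul_left, conj_trivial] at h2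
      simp only [_root_.neg_apply, inner_neg_left, zero_mul, zero_add,
        _root_.zero_apply, inner_zero_left, add_zero]
      nlinarith [mul_nonneg hη.le (sq_nonneg ‖k.2‖), mul_nonneg hα.le (sq_nonneg ‖k.2‖)]
    intro k
    have := key k
    simp only [_root_.neg_apply, inner_neg_left, inner_zero_right, zero_mul, norm_zero] at this
    linarith

theorem exists_jet_near [CompleteSpace E] {S : Set E} {w h : E → ℝ} {Z Y : E → E} {α : ℝ}
    {a v : E} (H : IsLasryLions S (fun z => w z - ⟪v, z - a⟫) α h Z Y) (hα : 0 < α)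
    (hpa : (12 * α) • (a - Y a) = 0) (hga : h (Y a) + 6 * α * ‖a - Y a‖ ^ 2 = w a)
    {ε : ℝ} (hε : 0 < ε) :
    ∃ δ > 0, ∀ x, ‖x - a‖ ≤ δ → ∀ P : E →L[ℝ] E,
      HasFDerivAt (fun x => (12 * α) • (x - Y x)) P x →
      (∀ e, e ≠ 0 → ⟪P e, e⟫ < 12 * α * ‖e‖ ^ 2) →
      ∃ z ∈ S, ∃ q, ‖z - a‖ ≤ ε ∧ |w z - w a| ≤ ε ∧ ‖q - v‖ ≤ ε ∧
        (∀ η > 0, ∀ᶠ k in 𝓝 0, z + k ∈ S →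
          w (z + k) ≤ w z + ⟪q, k⟫ + 1 / 2 * ⟪P k, k⟫ + η * ‖k‖ ^ 2) ∧
        ∀ k, -(3 * α) * ‖k‖ ^ 2 ≤ ⟪P k, k⟫ := by
  set p : E → E := fun x => (12 * α) • (x - Y x) with hp
  set g : E → ℝ := fun x => h (Y x) + 6 * α * ‖x - Y x‖ ^ 2 with hg
  set ζ : E → E := fun x => x + (3 * α)⁻¹ • p x with hζ
  have hpc : Continuous p := (H.lipschitz hα).continuous
  have hgc : Continuous g :=
    continuous_iff_continuousAt.2 fun x => (H.hasGradientAt hα x).continuousAt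
  have hζc : Continuous ζ := by fun_prop
  have hζa : ζ a = a := by simp [hζ, hp, hpa]
  have e1 : ∀ᶠ x in 𝓝 a, ‖ζ x - a‖ < ε := by
    have : Continuous fun x => ‖ζ x - a‖ := by fun_prop
    exact (this.tendsto' a 0 (by simp [hζa])).eventually (gt_mem_nhds hε)
  have e2 : ∀ᶠ x in 𝓝 a,
      |g x + 3 * α / 2 * ‖x - ζ x‖ ^ 2 + ⟪v, ζ x - a⟫ - w a| < ε := by
    have : Continuous fun x => |g x + 3 * α / 2 * ‖x - ζ x‖ ^ 2 + ⟪v, ζ x - a⟫ - w a| := by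
      fun_prop
    exact (this.tendsto' a 0 (by simp [hζa, hg, hga])).eventually (gt_mem_nhds hε)
  have e3 : ∀ᶠ x in 𝓝 a, ‖p x‖ < ε :=
    (hpc.norm.tendsto' a 0 (by simp [hp, hpa])).eventually (gt_mem_nhds hε)
  obtain ⟨r, hr, hball⟩ := Metric.eventually_nhds_iff_ball.1 (e1.and (e2.and e3))
  refine ⟨r / 2, half_pos hr, fun x hx P hP hlt => ?_⟩
  obtain ⟨h1, h2, h3⟩ := hball x (by rw [Metric.mem_ball, dist_eq_norm]; linarith)
  obtain ⟨z, hz, hzx, hwz, hjet, hlow⟩ := H.exists_jet hα hP hlt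
  have hzζ : z = ζ x := hzx
  refine ⟨z, hz, p x + v, by rw [hzζ]; exact h1.le, ?_, by simpa using h3.le, ?_, hlow⟩
  · have : w z = g x + 3 * α / 2 * ‖x - ζ x‖ ^ 2 + ⟪v, ζ x - a⟫ := by
      rw [← hzζ]; linarith
    rw [this]; exact h2.le
  · intro η hη
    filter_upwards [hjet η hη] with k hk hzk
    have h4 := hk hzk
    rw [inner_add_left]
    rw [add_sub_right_comm z k a, inner_add_right] at h4
    linarith

theorem add_le {S : Set E} {w₁ w₂ h₁ h₂ : E → ℝ} {Z₁ Z₂ Y₁ Y₂ : E → E} {α M : ℝ} {a b : E}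
    (H₁ : IsLasryLions S w₁ α h₁ Z₁ Y₁) (H₂ : IsLasryLions S w₂ α h₂ Z₂ Y₂) (hα : 0 < α)
    (hM : ∀ z₁ ∈ S, ∀ z₂ ∈ S, w₁ z₁ + w₂ z₂ ≤ M + α / 2 * ‖(z₁ - a) - (z₂ - b)‖ ^ 2)
    (x₁ x₂ : E) :
    (h₁ (Y₁ x₁) + 6 * α * ‖x₁ - Y₁ x₁‖ ^ 2) + (h₂ (Y₂ x₂) + 6 * α * ‖x₂ - Y₂ x₂‖ ^ 2)
      ≤ M + 3 * α / 2 * ‖(x₁ - a) - (x₂ - b)‖ ^ 2 := by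
  obtain ⟨c, rfl⟩ : ∃ c, x₁ = a + c := ⟨x₁ - a, by abel⟩
  obtain ⟨e, rfl⟩ : ∃ e, x₂ = b + e := ⟨x₂ - b, by abel⟩
  set y₁ := a + c - (4 : ℝ)⁻¹ • (c - e) with hy₁
  set y₂ := b + e + (4 : ℝ)⁻¹ • (c - e) with hy₂
  have h1 := H₁.min (a + c) y₁
  have h2 := H₂.min (b + e) y₂
  rw [H₁.h_eq y₁] at h1
  rw [H₂.h_eq y₂] at h2
  have h3 := hM _ (H₁.mem y₁) _ (H₂.mem y₂)
  obtain ⟨s, hs⟩ : ∃ s, Z₁ y₁ = a + s := ⟨Z₁ y₁ - a, by abel⟩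
  obtain ⟨t, ht⟩ : ∃ t, Z₂ y₂ = b + t := ⟨Z₂ y₂ - b, by abel⟩
  rw [hs] at h1 h3
  rw [ht] at h2 h3
  have h4 : 0 ≤ α * ‖(c - (4 : ℝ)⁻¹ • (c - e) - s) + (e + (4 : ℝ)⁻¹ • (c - e) - t)‖ ^ 2 := by
    positivity
  have h5 : 0 ≤ α * ‖(s - t) - (3 : ℝ) • (c - e)‖ ^ 2 := by positivity
  rw [show a + c - y₁ = (4 : ℝ)⁻¹ • (c - e) by rw [hy₁]; abel,
    show y₁ - (a + s) = c - (4 : ℝ)⁻¹ • (c - e) - s by rw [hy₁]; abel] at h1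
  rw [show b + e - y₂ = -((4 : ℝ)⁻¹ • (c - e)) by rw [hy₂]; abel,
    show y₂ - (b + t) = e + (4 : ℝ)⁻¹ • (c - e) - t by rw [hy₂]; abel, norm_neg] at h2
  simp only [add_sub_cancel_left] at h3 ⊢
  refine le_trans (add_le_add h1 h2) ?_
  simp only [← real_inner_self_eq_norm_sq, inner_sub_left, inner_sub_right, inner_smul_left,
    inner_smul_right, inner_add_left, inner_add_right, real_inner_comm, conj_trivial]
    at h3 h4 h5 ⊢
  linarith

end IsLasryLions

/-- The theorem on sums (Crandall–Ishii lemma) for the penalization `α / 2 * ‖x - y‖ ^ 2`, before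
passing to the limit in the second-order jets. -/
theorem exists_approx_jets [FiniteDimensional ℝ E] {S : Set E} (hS : IsCompact S)
    {w₁ w₂ : E → ℝ} (hw₁ : UpperSemicontinuousOn w₁ S) (hw₂ : UpperSemicontinuousOn w₂ S)
    {a b : E} (ha : a ∈ S) (hb : b ∈ S) {α : ℝ} (hα : 0 < α)
    (hmax : ∀ x ∈ S, ∀ y ∈ S,
      w₁ x + w₂ y - α / 2 * ‖x - y‖ ^ 2 ≤ w₁ a + w₂ b - α / 2 * ‖a - b‖ ^ 2)
    {ε : ℝ} (hε : 0 < ε) :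
    ∃ z₁ ∈ S, ∃ z₂ ∈ S, ∃ (q₁ q₂ : E) (P₁ P₂ : E →L[ℝ] E),
      ‖z₁ - a‖ ≤ ε ∧ ‖z₂ - b‖ ≤ ε ∧ |w₁ z₁ - w₁ a| ≤ ε ∧ |w₂ z₂ - w₂ b| ≤ ε ∧
      ‖q₁ - α • (a - b)‖ ≤ ε ∧ ‖q₂ - -(α • (a - b))‖ ≤ ε ∧
      (∀ η > 0, ∀ᶠ k in 𝓝 0, z₁ + k ∈ S →
        w₁ (z₁ + k) ≤ w₁ z₁ + ⟪q₁, k⟫ + 1 / 2 * ⟪P₁ k, k⟫ + η * ‖k‖ ^ 2) ∧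
      (∀ η > 0, ∀ᶠ k in 𝓝 0, z₂ + k ∈ S →
        w₂ (z₂ + k) ≤ w₂ z₂ + ⟪q₂, k⟫ + 1 / 2 * ⟪P₂ k, k⟫ + η * ‖k‖ ^ 2) ∧
      (∀ k, -(3 * α) * ‖k‖ ^ 2 ≤ ⟪P₁ k, k⟫) ∧ (∀ k, -(3 * α) * ‖k‖ ^ 2 ≤ ⟪P₂ k, k⟫) ∧
      ∀ k₁ k₂, ⟪P₁ k₁, k₁⟫ + ⟪P₂ k₂, k₂⟫
        ≤ 3 * α * ‖k₁ - k₂‖ ^ 2 + ε * (‖k₁‖ ^ 2 + ‖k₂‖ ^ 2) := by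
  set v := α • (a - b) with hv
  have hlin : ∀ u c : E, UpperSemicontinuousOn (fun z => -⟪u, z - c⟫) S := fun u c =>
    (by fun_prop : Continuous fun z => -⟪u, z - c⟫).upperSemicontinuous.upperSemicontinuousOn S
  have hu₁ : UpperSemicontinuousOn (fun z => w₁ z - ⟪v, z - a⟫) S := by
    simpa only [sub_eq_add_neg] using hw₁.add (hlin v a)
  have hu₂ : UpperSemicontinuousOn (fun z => w₂ z - ⟪-v, z - b⟫) S := by
    simpa only [sub_eq_add_neg] using hw₂.add (hlin (-v) b)
  obtain ⟨h₁, Z₁, Y₁, H₁⟩ := exists_isLasryLions hS ⟨a, ha⟩ hu₁ hα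
  obtain ⟨h₂, Z₂, Y₂, H₂⟩ := exists_isLasryLions hS ⟨a, ha⟩ hu₂ hα
  have hsum := H₁.add_le H₂ hα (M := w₁ a + w₂ b) (a := a) (b := b) (by
    intro z₁ hz₁ z₂ hz₂
    have h1 := hmax z₁ hz₁ z₂ hz₂
    rw [hv]
    simp only [← real_inner_self_eq_norm_sq, inner_sub_left, inner_sub_right, inner_smul_left,
      inner_neg_left, real_inner_comm, conj_trivial] at h1 ⊢
    linarith)
  have hge₁ := H₁.le_inf_convolution hα a ha
  have hge₂ := H₂.le_inf_convolution hα b hb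
  have hab := hsum a b
  simp only [sub_self, norm_zero, inner_zero_right] at hge₁ hge₂ hab
  have hga₁ : h₁ (Y₁ a) + 6 * α * ‖a - Y₁ a‖ ^ 2 = w₁ a := by linarith
  have hga₂ : h₂ (Y₂ b) + 6 * α * ‖b - Y₂ b‖ ^ 2 = w₂ b := by linarith
  have hpa₁ : (12 * α) • (a - Y₁ a) = 0 := by
    refine (H₁.hasGradientAt hα a).eq_of_forall_sub_le (C := 3 * α / 2) fun k => ?_
    have := hsum (a + k) b
    simp only [sub_self, sub_zero, add_sub_cancel_left, inner_zero_left] at this ⊢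
    linarith
  have hpa₂ : (12 * α) • (b - Y₂ b) = 0 := by
    refine (H₂.hasGradientAt hα b).eq_of_forall_sub_le (C := 3 * α / 2) fun k => ?_
    have := hsum a (b + k)
    simp only [sub_self, zero_sub, add_sub_cancel_left, inner_zero_left, norm_neg] at this ⊢
    linarith
  obtain ⟨δ₁, hδ₁, hj₁⟩ := H₁.exists_jet_near hα hpa₁ hga₁ hε
  obtain ⟨δ₂, hδ₂, hj₂⟩ := H₂.exists_jet_near hα hpa₂ hga₂ hε
  obtain ⟨δ, hδ, hδle⟩ : ∃ δ > 0, δ ≤ δ₁ ∧ δ ≤ δ₂ ∧ δ ≤ ε ∧ δ ≤ α :=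
    ⟨min (min δ₁ δ₂) (min ε α), by positivity, by simp, by simp, by simp, by simp⟩
  obtain ⟨x₁, x₂, P₁, P₂, hx₁, hx₂, hP₁, hP₂, hquad⟩ := exists_second_order_max (β := 3 * α)
    (H₁.hasGradientAt hα) (H₂.hasGradientAt hα) (H₁.lipschitz hα) (H₂.lipschitz hα)
    (a := a) (b := b) (fun x₁ x₂ => by rw [hga₁, hga₂]; exact hsum x₁ x₂) hδ
  have hlt₁ : ∀ e, e ≠ 0 → ⟪P₁ e, e⟫ < 12 * α * ‖e‖ ^ 2 := by
    intro e he
    have h1 := hquad e 0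
    have h2 : 0 < ‖e‖ ^ 2 := by positivity
    simp only [map_zero, inner_zero_left, sub_zero, norm_zero] at h1
    nlinarith
  have hlt₂ : ∀ e, e ≠ 0 → ⟪P₂ e, e⟫ < 12 * α * ‖e‖ ^ 2 := by
    intro e he
    have h1 := hquad 0 e
    have h2 : 0 < ‖e‖ ^ 2 := by positivity
    simp only [map_zero, inner_zero_left, zero_sub, norm_neg, norm_zero] at h1
    nlinarith
  obtain ⟨z₁, hz₁, q₁, hza₁, hw₁, hq₁, hjet₁, hlow₁⟩ := hj₁ x₁ (hx₁.trans hδle.1) P₁ hP₁ hlt₁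
  obtain ⟨z₂, hz₂, q₂, hza₂, hw₂, hq₂, hjet₂, hlow₂⟩ := hj₂ x₂ (hx₂.trans hδle.2.1) P₂ hP₂ hlt₂
  refine ⟨z₁, hz₁, z₂, hz₂, q₁, q₂, P₁, P₂, hza₁, hza₂, hw₁, hw₂, hq₁, hq₂, hjet₁, hjet₂, hlow₁,
    hlow₂, fun k₁ k₂ => (hquad k₁ k₂).trans ?_⟩
  have := mul_le_mul_of_nonneg_right hδle.2.2.1 (by positivity : 0 ≤ ‖k₁‖ ^ 2 + ‖k₂‖ ^ 2)
  linarith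

end TheoremOnSums

section MatrixJets

open scoped RealInnerProductSpace

variable {n : ℕ}

/-- The matrix of the bilinear form `(x, y) ↦ ⟪T x, y⟫`. -/
def formMatrix (T : En n →L[ℝ] En n) : Symn n :=
  Matrix.of fun i j => ⟪T (EuclideanSpace.single i 1), EuclideanSpace.single j 1⟫

theorem dotProduct_formMatrix_mulVec (T : En n →L[ℝ] En n) (x y : Fin n → ℝ) :
    x ⬝ᵥ formMatrix T *ᵥ y = ⟪T (WithLp.toLp 2 x), WithLp.toLp 2 y⟫ := by
  have hx : ∀ x : Fin n → ℝ, WithLp.toLp 2 x = ∑ i, x i • EuclideanSpace.single i (1 : ℝ) := by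
    intro x
    ext j
    simp [Finset.sum_apply, Pi.single_apply]
  rw [hx x, hx y, map_sum, sum_inner]
  simp only [dotProduct, mulVec, inner_sum, map_smul, real_inner_smul_left, real_inner_smul_right,
    formMatrix, Matrix.of_apply, Finset.mul_sum]
  refine Finset.sum_congr rfl fun i _ => Finset.sum_congr rfl fun j _ => by ring

theorem exists_touchAbove {Ω : Set (En n)} {w : En n → ℝ} {z q : En n} {T : En n →L[ℝ] En n}
    (hT : ∀ x y, ⟪T x, y⟫ = ⟪T y, x⟫) {δ : ℝ} (hδ : 0 < δ)
    (h : ∀ᶠ k in 𝓝 0, z + k ∈ Ω →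
      w (z + k) ≤ w z + ⟪q, k⟫ + 1 / 2 * ⟪T k, k⟫ - δ * ‖k‖ ^ 2) :
    ∃ φ : En n → ℝ, ContDiff ℝ 2 φ ∧ TouchAbove Ω φ w z ∧ gradient φ z = q ∧
      hess φ z = formMatrix T := by
  have hd : ∀ y, HasFDerivAt (fun y => w z + ⟪q, y - z⟫ + 1 / 2 * ⟪T (y - z), y - z⟫)
      (innerSL ℝ q + innerSL ℝ (T (y - z))) y := by
    intro y
    have h1 : HasFDerivAt (fun y : En n => y - z) (ContinuousLinearMap.id ℝ (En n)) y :=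
      (hasFDerivAt_id y).sub_const z
    have h2 := (T.hasFDerivAt (x := y - z)).comp y h1
    have h3 := (((hasFDerivAt_const q y).inner ℝ h1).const_add (w z)).add
      ((h2.inner ℝ h1).const_mul (1 / 2 : ℝ))
    refine h3.congr_fderiv ?_
    ext k
    simp [hT k (y - z), inner_sub_left]
    ring
  have hfd : fderiv ℝ (fun y => w z + ⟪q, y - z⟫ + 1 / 2 * ⟪T (y - z), y - z⟫) =
      fun y => innerSL ℝ q + innerSL ℝ (T (y - z)) := funext fun y => (hd y).fderiv
  have hs : ContDiff ℝ 2 fun y : En n => y - z := contDiff_id.sub contDiff_const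
  refine ⟨fun y => w z + ⟪q, y - z⟫ + 1 / 2 * ⟪T (y - z), y - z⟫,
    (contDiff_const.add (contDiff_const.inner ℝ hs)).add
      (contDiff_const.mul ((T.contDiff.comp hs).inner ℝ hs)), ⟨by simp, ?_⟩, ?_, ?_⟩
  · obtain ⟨ρ, hρ, hb⟩ := Metric.eventually_nhds_iff.1 h
    refine ⟨Metric.ball z ρ, Metric.isOpen_ball, Metric.mem_ball_self hρ, ?_⟩
    rintro y ⟨⟨hy, hyΩ⟩, hne⟩
    have := @hb (y - z) (by simpa [dist_eq_norm] using hy) (by simpa using hyΩ)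
    rw [add_sub_cancel] at this
    have h0 : 0 < ‖y - z‖ := norm_pos_iff.2 (sub_ne_zero.2 hne)
    have : 0 < δ * ‖y - z‖ ^ 2 := by positivity
    show w y < w z + ⟪q, y - z⟫ + 1 / 2 * ⟪T (y - z), y - z⟫
    linarith
  · apply HasGradientAt.gradient
    rw [hasGradientAt_iff_hasFDerivAt]
    refine (hd z).congr_fderiv ?_
    ext k
    simp
  · ext i j
    have h1 : HasFDerivAt (fun y => innerSL ℝ q + innerSL ℝ (T (y - z)))
        ((innerSL ℝ).comp T) z := by
      have h1 : HasFDerivAt (fun y : En n => y - z) (ContinuousLinearMap.id ℝ (En n)) z :=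
        (hasFDerivAt_id z).sub_const z
      have h2 := HasFDerivAt.comp (f := fun y : En n => y - z) z
        ((innerSL ℝ).comp T : En n →L[ℝ] En n →L[ℝ] ℝ).hasFDerivAt h1
      exact h2.const_add (innerSL ℝ q)
    rw [hess, Matrix.of_apply, iteratedFDeriv_two_apply, hfd, h1.fderiv]
    simp [formMatrix]

/-- `(p, X)` belongs to the limiting second-order superjet of `w` at `x`, relative to `Ω`. -/
def LimJet (Ω : Set (En n)) (w : En n → ℝ) (x p : En n) (X : Symn n) : Prop :=
  ∃ (z : ℕ → En n) (φ : ℕ → En n → ℝ),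
    (∀ k, z k ∈ Ω ∧ ContDiff ℝ 2 (φ k) ∧ TouchAbove Ω (φ k) w (z k) ∧
      (hess (φ k) (z k)).IsSymm) ∧
    Tendsto z atTop (𝓝 x) ∧ Tendsto (fun k => w (z k)) atTop (𝓝 (w x)) ∧
    Tendsto (fun k => gradient (φ k) (z k)) atTop (𝓝 p) ∧
    Tendsto (fun k => hess (φ k) (z k)) atTop (𝓝 X)

theorem exists_test_function {Ω S : Set (En n)} (hΩS : Ω ⊆ S) {w : En n → ℝ} {z q : En n}
    {P : En n →L[ℝ] En n} {δ : ℝ} (hδ : 0 < δ)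
    (h : ∀ η > 0, ∀ᶠ k in 𝓝 0, z + k ∈ S →
      w (z + k) ≤ w z + ⟪q, k⟫ + 1 / 2 * ⟪P k, k⟫ + η * ‖k‖ ^ 2) :
    ∃ φ : En n → ℝ, ContDiff ℝ 2 φ ∧ TouchAbove Ω φ w z ∧ gradient φ z = q ∧
      (hess φ z).IsSymm ∧ ∀ k : Fin n → ℝ, k ⬝ᵥ hess φ z *ᵥ k =
        ⟪P (WithLp.toLp 2 k), WithLp.toLp 2 k⟫ + δ * ‖WithLp.toLp 2 k‖ ^ 2 := by
  let T : En n →L[ℝ] En n := (1 / 2 : ℝ) • (P + ContinuousLinearMap.adjoint P) +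
    δ • ContinuousLinearMap.id ℝ (En n)
  have hT : ∀ x y, ⟪T x, y⟫ = ⟪T y, x⟫ := by
    intro x y
    simp only [T, _root_.add_apply, _root_.smul_apply,
      ContinuousLinearMap.id_apply, inner_add_left, real_inner_smul_left,
      ContinuousLinearMap.adjoint_inner_left]
    rw [real_inner_comm y x, real_inner_comm (P y) x, real_inner_comm (P x) y]
    ring
  have hTq : ∀ k, ⟪T k, k⟫ = ⟪P k, k⟫ + δ * ‖k‖ ^ 2 := by
    intro k
    simp only [T, _root_.add_apply, _root_.smul_apply,
      ContinuousLinearMap.id_apply, inner_add_left, real_inner_smul_left,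
      ContinuousLinearMap.adjoint_inner_left, real_inner_self_eq_norm_sq]
    rw [real_inner_comm (P k) k]
    ring
  obtain ⟨φ, h1, h2, h3, h4⟩ := exists_touchAbove (Ω := Ω) (w := w) (z := z) (q := q) hT
    (δ := δ / 4) (by positivity) (by
      filter_upwards [h (δ / 4) (by positivity)] with k hk hkΩ
      rw [hTq]
      linarith [hk (hΩS hkΩ)])
  refine ⟨φ, h1, h2, h3, ?_, fun k => ?_⟩
  · rw [h4]
    ext i j
    simp only [Matrix.transpose_apply, formMatrix, Matrix.of_apply]
    exact hT _ _
  · rw [h4, dotProduct_formMatrix_mulVec, hTq]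

theorem norm_toLp_sq (k : Fin n → ℝ) : ‖WithLp.toLp 2 k‖ ^ 2 = k ⬝ᵥ k := by
  rw [EuclideanSpace.norm_sq_eq]
  simp [dotProduct, sq]

theorem abs_entry_le {A : Symn n} (hA : A.IsSymm) {c : ℝ}
    (h : ∀ k : Fin n → ℝ, |k ⬝ᵥ A *ᵥ k| ≤ c * (k ⬝ᵥ k)) (i j : Fin n) : |A i j| ≤ c := by
  set e : Fin n → Fin n → ℝ := fun i => Pi.single i 1
  have hv : ∀ i j, e i ⬝ᵥ A *ᵥ e j = A i j := by simp [e]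
  have hs : A j i = A i j := hA.apply i j
  have h1 := h (e i + e j)
  have h2 := h (e i - e j)
  have he : ∀ i, e i ⬝ᵥ e i = 1 := by simp [e]
  simp only [mulVec_add, mulVec_sub, add_dotProduct, dotProduct_add, sub_dotProduct,
    dotProduct_sub, hv, he, hs, dotProduct_comm (e j) (e i)] at h1 h2
  rw [abs_le] at *
  constructor <;> linarith

theorem exists_limJets {Ω : Set (En n)} (hΩ : IsOpen Ω) (hΩb : IsBounded Ω)
    {w₁ w₂ : En n → ℝ} (hw₁ : UpperSemicontinuousOn w₁ (closure Ω))
    (hw₂ : UpperSemicontinuousOn w₂ (closure Ω))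
    {a b : En n} (ha : a ∈ Ω) (hb : b ∈ Ω) {α : ℝ} (hα : 0 < α)
    (hmax : ∀ x ∈ closure Ω, ∀ y ∈ closure Ω,
      w₁ x + w₂ y - α / 2 * ‖x - y‖ ^ 2 ≤ w₁ a + w₂ b - α / 2 * ‖a - b‖ ^ 2) :
    ∃ X Y : Symn n, X.IsSymm ∧ Y.IsSymm ∧
      LoewnerLE ((-(3 * α)) • (1 : Matrix (Fin n ⊕ Fin n) (Fin n ⊕ Fin n) ℝ))
        (Matrix.fromBlocks X 0 0 Y) ∧
      LoewnerLE (Matrix.fromBlocks X 0 0 Y)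
        ((3 * α) • Matrix.fromBlocks 1 (-1) (-1) (1 : Symn n)) ∧
      LimJet Ω w₁ a (α • (a - b)) X ∧ LimJet Ω w₂ b (-(α • (a - b))) Y := by
  obtain ⟨ε₁, hε₁, hball₁⟩ := Metric.isOpen_iff.1 hΩ a ha
  obtain ⟨ε₂, hε₂, hball₂⟩ := Metric.isOpen_iff.1 hΩ b hb
  set ε : ℕ → ℝ := fun k => min 1 (min (ε₁ / 2) (ε₂ / 2)) / (k + 1) with hεdef
  have hm : 0 < min 1 (min (ε₁ / 2) (ε₂ / 2)) := by positivity
  have hεpos : ∀ k, 0 < ε k := fun k => by positivity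
  have hεle : ∀ k, ε k ≤ min 1 (min (ε₁ / 2) (ε₂ / 2)) := fun k =>
    div_le_self hm.le (by linarith [(Nat.cast_nonneg k : (0 : ℝ) ≤ k)])
  have hεlim : Tendsto ε atTop (𝓝 0) := by
    have := (tendsto_one_div_add_atTop_nhds_zero_nat (𝕜 := ℝ)).const_mul
      (min 1 (min (ε₁ / 2) (ε₂ / 2)))
    simpa [hεdef, div_eq_mul_inv] using this
  have key : ∀ k, ∃ z₁ ∈ Ω, ∃ z₂ ∈ Ω, ∃ φ₁ φ₂ : En n → ℝ,
      (ContDiff ℝ 2 φ₁ ∧ TouchAbove Ω φ₁ w₁ z₁ ∧ (hess φ₁ z₁).IsSymm) ∧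
      (ContDiff ℝ 2 φ₂ ∧ TouchAbove Ω φ₂ w₂ z₂ ∧ (hess φ₂ z₂).IsSymm) ∧
      ‖z₁ - a‖ ≤ ε k ∧ ‖z₂ - b‖ ≤ ε k ∧ ‖w₁ z₁ - w₁ a‖ ≤ ε k ∧ ‖w₂ z₂ - w₂ b‖ ≤ ε k ∧
      ‖gradient φ₁ z₁ - α • (a - b)‖ ≤ ε k ∧ ‖gradient φ₂ z₂ - -(α • (a - b))‖ ≤ ε k ∧
      (∀ x : Fin n → ℝ, -(3 * α) * (x ⬝ᵥ x) ≤ x ⬝ᵥ hess φ₁ z₁ *ᵥ x) ∧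
      (∀ x : Fin n → ℝ, -(3 * α) * (x ⬝ᵥ x) ≤ x ⬝ᵥ hess φ₂ z₂ *ᵥ x) ∧
      ∀ x y : Fin n → ℝ, x ⬝ᵥ hess φ₁ z₁ *ᵥ x + y ⬝ᵥ hess φ₂ z₂ *ᵥ y ≤
        3 * α * ((x - y) ⬝ᵥ (x - y)) + ε k * (x ⬝ᵥ x + y ⬝ᵥ y) := by
    intro k
    obtain ⟨z₁, hz₁, z₂, hz₂, q₁, q₂, P₁, P₂, h1, h2, h3, h4, h5, h6, h7, h8, h9, h10, h11⟩ :=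
      exists_approx_jets hΩb.isCompact_closure hw₁ hw₂ (subset_closure ha) (subset_closure hb)
        hα hmax (ε := ε k / 2) (half_pos (hεpos k))
    have hδ : 0 < ε k / 2 := half_pos (hεpos k)
    have hle := hεle k
    simp only [le_min_iff] at hle
    obtain ⟨φ₁, a1, a2, a3, a4, a5⟩ := exists_test_function (subset_closure (s := Ω)) hδ h7
    obtain ⟨φ₂, b1, b2, b3, b4, b5⟩ := exists_test_function (subset_closure (s := Ω)) hδ h8
    refine ⟨z₁, hball₁ ?_, z₂, hball₂ ?_, φ₁, φ₂, ⟨a1, a2, a4⟩, ⟨b1, b2, b4⟩, by linarith,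
      by linarith, by rw [Real.norm_eq_abs]; linarith, by rw [Real.norm_eq_abs]; linarith,
      by rw [a3]; linarith, by rw [b3]; linarith, fun x => ?_, fun x => ?_, fun x y => ?_⟩
    · rw [Metric.mem_ball, dist_eq_norm]; linarith
    · rw [Metric.mem_ball, dist_eq_norm]; linarith
    · rw [a5, ← norm_toLp_sq]
      have := mul_nonneg hδ.le (sq_nonneg ‖WithLp.toLp 2 x‖)
      linarith [h9 (WithLp.toLp 2 x)]
    · rw [b5, ← norm_toLp_sq]
      have := mul_nonneg hδ.le (sq_nonneg ‖WithLp.toLp 2 x‖)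
      linarith [h10 (WithLp.toLp 2 x)]
    · rw [a5, b5, ← norm_toLp_sq, ← norm_toLp_sq, ← norm_toLp_sq]
      have := h11 (WithLp.toLp 2 x) (WithLp.toLp 2 y)
      rw [← WithLp.toLp_sub] at this
      linarith
  choose z₁ hz₁ z₂ hz₂ φ₁ φ₂ hφ₁ hφ₂ h1 h2 h3 h4 h5 h6 h7 h8 h9 using key
  set A : ℕ → Symn n := fun k => hess (φ₁ k) (z₁ k)
  set B : ℕ → Symn n := fun k => hess (φ₂ k) (z₂ k)
  set c : ℝ := 3 * α + 1
  have hbd : ∀ k, (∀ i j, |A k i j| ≤ c) ∧ (∀ i j, |B k i j| ≤ c) := by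
    intro k
    have hle := hεle k
    simp only [le_min_iff] at hle
    refine ⟨abs_entry_le (hφ₁ k).2.2 fun x => abs_le.2 ⟨?_, ?_⟩,
      abs_entry_le (hφ₂ k).2.2 fun x => abs_le.2 ⟨?_, ?_⟩⟩
    all_goals
      have hx : 0 ≤ x ⬝ᵥ x := by rw [← norm_toLp_sq]; positivity
      have hx' : ε k * (x ⬝ᵥ x) ≤ 1 * (x ⬝ᵥ x) := mul_le_mul_of_nonneg_right hle.1 hx
      simp only [c]
    · linarith [h7 k x]
    · have := h9 k x 0
      simp only [sub_zero, dotProduct_zero, zero_dotProduct, add_zero] at this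
      linarith
    · linarith [h8 k x]
    · have := h9 k 0 x
      simp only [zero_sub, dotProduct_zero, zero_dotProduct, zero_add, neg_dotProduct,
        dotProduct_neg, neg_neg] at this
      linarith
  have : FirstCountableTopology (Symn n) :=
    inferInstanceAs (FirstCountableTopology (Fin n → Fin n → ℝ))
  let K : Set (Symn n) := Set.univ.pi fun _ => Set.univ.pi fun _ => Set.Icc (-c) c
  have hK : IsCompact K := isCompact_univ_pi fun _ => isCompact_univ_pi fun _ => isCompact_Icc
  obtain ⟨⟨X, Y⟩, -, σ, hσ, hlim⟩ := (hK.prod hK).tendsto_subseq (x := fun k => (A k, B k))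
    (fun k => ⟨fun i _ j _ => abs_le.1 ((hbd k).1 i j), fun i _ j _ => abs_le.1 ((hbd k).2 i j)⟩)
  have hA : Tendsto (fun k => A (σ k)) atTop (𝓝 X) := (continuous_fst.tendsto _).comp hlim
  have hB : Tendsto (fun k => B (σ k)) atTop (𝓝 Y) := (continuous_snd.tendsto _).comp hlim
  have hεσ : Tendsto (fun k => ε (σ k)) atTop (𝓝 0) := hεlim.comp hσ.tendsto_atTop
  have hsymm : ∀ {C : ℕ → Symn n} {Z : Symn n}, Tendsto C atTop (𝓝 Z) →
      (∀ k, (C k).IsSymm) → Z.IsSymm := fun {C Z} hC hs =>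
    tendsto_nhds_unique ((continuous_id.matrix_transpose.tendsto Z).comp hC)
      (hC.congr fun k => (hs k).symm)
  have hquad : ∀ {C : ℕ → Symn n} {Z : Symn n}, Tendsto C atTop (𝓝 Z) → ∀ x : Fin n → ℝ,
      Tendsto (fun k => x ⬝ᵥ C k *ᵥ x) atTop (𝓝 (x ⬝ᵥ Z *ᵥ x)) := fun {C Z} hC x =>
    ((continuous_const.dotProduct (continuous_id.matrix_mulVec continuous_const)).tendsto Z).comp hC
  have hto : ∀ {G : Type} [NormedAddCommGroup G] {g : ℕ → G} {l : G}, (∀ k, ‖g k - l‖ ≤ ε k) →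
      Tendsto (fun k => g (σ k)) atTop (𝓝 l) := fun {G} _ {g l} h =>
    tendsto_iff_norm_sub_tendsto_zero.2
      (squeeze_zero (fun _ => norm_nonneg _) (fun k => h (σ k)) hεσ)
  have hXs : X.IsSymm := hsymm hA fun k => (hφ₁ (σ k)).2.2
  have hYs : Y.IsSymm := hsymm hB fun k => (hφ₂ (σ k)).2.2
  refine ⟨X, Y, hXs, hYs, ?_, ?_, ?_, ?_⟩
  · refine Matrix.PosSemidef.of_dotProduct_mulVec_nonneg ?_ fun v => ?_
    · rw [Matrix.IsHermitian, Matrix.conjTranspose_eq_transpose_of_trivial]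
      simp [Matrix.fromBlocks_transpose, hXs.eq, hYs.eq]
    · obtain ⟨x, y, rfl⟩ : ∃ x y, v = Sum.elim x y := ⟨v ∘ Sum.inl, v ∘ Sum.inr, by simp⟩
      have e1 := ge_of_tendsto' (hquad hA x) fun k => h7 (σ k) x
      have e2 := ge_of_tendsto' (hquad hB y) fun k => h8 (σ k) y
      simp only [sub_mulVec, star_trivial, dotProduct_sub, smul_mulVec, dotProduct_smul,
        one_mulVec,
        fromBlocks_mulVec, Sum.elim_comp_inl, Sum.elim_comp_inr, zero_mulVec, add_zero, zero_add,
        sumElim_dotProduct_sumElim, smul_eq_mul]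
      linarith
  · refine Matrix.PosSemidef.of_dotProduct_mulVec_nonneg ?_ fun v => ?_
    · rw [Matrix.IsHermitian, Matrix.conjTranspose_eq_transpose_of_trivial]
      simp [Matrix.fromBlocks_transpose, hXs.eq, hYs.eq]
    · obtain ⟨x, y, rfl⟩ : ∃ x y, v = Sum.elim x y := ⟨v ∘ Sum.inl, v ∘ Sum.inr, by simp⟩
      have e1 := le_of_tendsto_of_tendsto' ((hquad hA x).add (hquad hB y))
        ((hεσ.mul_const (x ⬝ᵥ x + y ⬝ᵥ y)).const_add (3 * α * ((x - y) ⬝ᵥ (x - y))))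
        fun k => h9 (σ k) x y
      simp only [sub_dotProduct, dotProduct_sub] at e1
      simp only [sub_mulVec, star_trivial, dotProduct_sub, smul_mulVec, dotProduct_smul,
        one_mulVec,
        fromBlocks_mulVec, Sum.elim_comp_inl, Sum.elim_comp_inr, zero_mulVec, add_zero, zero_add, neg_mulVec,
        sumElim_dotProduct_sumElim, smul_eq_mul, dotProduct_add, dotProduct_neg]
      linarith
  · exact ⟨fun k => z₁ (σ k), fun k => φ₁ (σ k), fun k => ⟨hz₁ _, (hφ₁ _).1, (hφ₁ _).2⟩,
      hto h1, hto h3, hto h5, hA⟩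
  · exact ⟨fun k => z₂ (σ k), fun k => φ₂ (σ k), fun k => ⟨hz₂ _, (hφ₂ _).1, (hφ₂ _).2⟩,
      hto h2, hto h4, hto h6, hB⟩

end MatrixJets

section Penalization

theorem exists_penalized_max {E : Type*} [NormedAddCommGroup E] {S Ω : Set E} (hS : IsCompact S)
    (hΩ : IsOpen Ω) {W : E × E → ℝ} (hW : UpperSemicontinuousOn W (S ×ˢ S)) {x₀ : E}
    (hx₀ : x₀ ∈ S) (hpos : 0 < W (x₀, x₀)) (hbdry : ∀ x ∈ S \ Ω, W (x, x) ≤ 0)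
    {ε : ℝ} (hε : 0 < ε) :
    ∃ α > 0, ∃ x ∈ Ω, ∃ y ∈ Ω, α * ‖x - y‖ ^ 2 + 1 / α < ε ∧ W (x₀, x₀) ≤ W (x, y) ∧
      ∀ x' ∈ S, ∀ y' ∈ S,
        W (x', y') - α / 2 * ‖x' - y'‖ ^ 2 ≤ W (x, y) - α / 2 * ‖x - y‖ ^ 2 := by
  have hmax : ∀ k : ℕ, ∃ z ∈ S ×ˢ S, ∀ z' ∈ S ×ˢ S,
      W z' - 2 ^ k / 2 * ‖z'.1 - z'.2‖ ^ 2 ≤ W z - 2 ^ k / 2 * ‖z.1 - z.2‖ ^ 2 := by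
    intro k
    have hc : Continuous fun z : E × E => -((2 : ℝ) ^ k / 2 * ‖z.1 - z.2‖ ^ 2) := by fun_prop
    obtain ⟨z, hz, hmax⟩ := UpperSemicontinuousOn.exists_isMaxOn
      (⟨(x₀, x₀), hx₀, hx₀⟩ : (S ×ˢ S).Nonempty) (hS.prod hS) (hW.add (hc.upperSemicontinuous.upperSemicontinuousOn _))
    exact ⟨z, hz, fun z' hz' => by simpa [sub_eq_add_neg] using hmax hz'⟩
  choose z hz hzmax using hmax
  set M : ℕ → ℝ := fun k => W (z k) - 2 ^ k / 2 * ‖(z k).1 - (z k).2‖ ^ 2 with hM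
  have hlow : ∀ k, W (x₀, x₀) ≤ M k := fun k => by simpa using hzmax k (x₀, x₀) ⟨hx₀, hx₀⟩
  have hWlow : ∀ k, W (x₀, x₀) ≤ W (z k) := fun k => by
    have : (0 : ℝ) ≤ 2 ^ k / 2 * ‖(z k).1 - (z k).2‖ ^ 2 := by positivity
    have h := hlow k
    simp only [hM] at h
    linarith
  have hstep : ∀ k, 2 ^ (k + 1) * ‖(z (k + 1)).1 - (z (k + 1)).2‖ ^ 2 ≤ 4 * (M k - M (k + 1)) := by
    intro k
    have := hzmax k (z (k + 1)) (hz _)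
    simp only [hM, pow_succ]
    linarith
  have hanti : Antitone M := antitone_nat_of_succ_le fun k => by
    have : (0 : ℝ) ≤ 2 ^ (k + 1) * ‖(z (k + 1)).1 - (z (k + 1)).2‖ ^ 2 := by positivity
    linarith [hstep k]
  have hconv := tendsto_atTop_ciInf hanti ⟨W (x₀, x₀), by rintro _ ⟨k, rfl⟩; exact hlow k⟩
  have hlim : Tendsto (fun k => 2 ^ (k + 1) * ‖(z (k + 1)).1 - (z (k + 1)).2‖ ^ 2) atTop
      (𝓝 (0 : ℝ)) := by
    have h := (hconv.sub ((tendsto_add_atTop_iff_nat 1).2 hconv)).const_mul 4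
    rw [sub_self, mul_zero] at h
    exact squeeze_zero (fun k => by positivity) hstep h
  have hdist : Tendsto (fun k => ‖(z (k + 1)).1 - (z (k + 1)).2‖ ^ 2) atTop (𝓝 0) :=
    squeeze_zero (fun k => by positivity)
      (fun k => le_mul_of_one_le_left (by positivity) (one_le_pow₀ (by norm_num))) hlim
  obtain ⟨⟨x, y⟩, hxy, σ, hσ, hσlim⟩ := (hS.prod hS).tendsto_subseq fun k => hz (k + 1)
  have hxy' : x = y := by
    have h1 : Tendsto (fun p : E × E => ‖p.1 - p.2‖ ^ 2) (𝓝 (x, y)) (𝓝 (‖x - y‖ ^ 2)) :=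
      Continuous.tendsto (f := fun p : E × E => ‖p.1 - p.2‖ ^ 2) (by fun_prop) (x, y)
    have := tendsto_nhds_unique (h1.comp hσlim) (hdist.comp hσ.tendsto_atTop)
    simpa [sub_eq_zero] using this
  subst hxy'
  have hxΩ : x ∈ Ω := by
    by_contra hx
    have h1 := hW (x, x) hxy _ ((hbdry x ⟨hxy.1, hx⟩).trans_lt hpos)
    have h2 : Tendsto ((fun k => z (k + 1)) ∘ σ) atTop (𝓝[S ×ˢ S] (x, x)) :=
      tendsto_nhdsWithin_iff.2 ⟨hσlim, Eventually.of_forall fun k => hz _⟩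
    obtain ⟨k, hk⟩ := (h2.eventually h1).exists
    exact absurd hk (hWlow _).not_gt
  have hinv : Tendsto (fun k : ℕ => 1 / (2 : ℝ) ^ (k + 1)) atTop (𝓝 0) := by
    have := (tendsto_add_atTop_iff_nat 1).2
      (tendsto_pow_atTop_nhds_zero_of_lt_one (r := (1 / 2 : ℝ)) (by norm_num) (by norm_num))
    simpa using this
  have h3 := ((hlim.add hinv).comp hσ.tendsto_atTop).eventually
    (Iio_mem_nhds (by rwa [add_zero] : (0 : ℝ) + 0 < ε))
  have h4 := hσlim.eventually ((hΩ.prod hΩ).mem_nhds ⟨hxΩ, hxΩ⟩)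
  obtain ⟨k, hk3, hk4⟩ := (h3.and h4).exists
  exact ⟨2 ^ (σ k + 1), by positivity, _, hk4.1, _, hk4.2, hk3, hWlow _,
    fun x' hx' y' hy' => hzmax (σ k + 1) (x', y') ⟨hx', hy'⟩⟩

end Penalization

section ReducedSystem

variable {n : ℕ} {ι : Type*}

theorem LimJet.nonpos [Finite ι] {Ω : Set (En n)} {G : En n → (ι → ℝ) → En n → Symn n → ℝ}
    (hG : ContinuousOn (fun q : En n × (ι → ℝ) × En n × Symn n => G q.1 q.2.1 q.2.2.1 q.2.2.2)
      (Ω ×ˢ Set.univ)) {i : ι}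
    (hmono : ∀ x ∈ Ω, ∀ (r ρ : ι → ℝ) (p : En n) (X : Symn n), X.IsSymm →
      (∀ k, r k ≤ ρ k) → r i = ρ i → G x ρ p X ≤ G x r p X)
    {U : ι → En n → ℝ} (hU : ∀ k, UpperSemicontinuousOn (U k) Ω)
    (hsub : ∀ x ∈ Ω, ∀ φ : En n → ℝ, ContDiff ℝ 2 φ → TouchAbove Ω φ (U i) x →
      G x (fun k => U k x) (gradient φ x) (hess φ x) ≤ 0)
    {x p : En n} {X : Symn n} (hx : x ∈ Ω) (hJ : LimJet Ω (U i) x p X) :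
    G x (fun k => U k x) p X ≤ 0 := by
  classical
  obtain ⟨z, φ, hz, hzx, hw, hp, hX⟩ := hJ
  set r : ℕ → ι → ℝ := fun k => Function.update (fun j => max (U j (z k)) (U j x)) i (U i (z k))
  have hzx' : Tendsto z atTop (𝓝[Ω] x) :=
    tendsto_nhdsWithin_iff.2 ⟨hzx, Eventually.of_forall fun k => (hz k).1⟩
  have hr : Tendsto r atTop (𝓝 fun j => U j x) := by
    refine tendsto_pi_nhds.2 fun j => ?_
    by_cases hj : j = i
    · subst hj
      simpa [r] using hw
    · simp only [r, Function.update_of_ne hj]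
      refine tendsto_order.2 ⟨fun c hc => Eventually.of_forall fun k => lt_max_of_lt_right hc,
        fun c hc => ?_⟩
      filter_upwards [hzx'.eventually (hU j x hx c hc)] with k hk
      exact max_lt hk hc
  have hle : ∀ k, G (z k) (r k) (gradient (φ k) (z k)) (hess (φ k) (z k)) ≤ 0 := fun k =>
    (hmono _ (hz k).1 (fun j => U j (z k)) _ _ _ (hz k).2.2.2 (fun j => by
      by_cases hj : j = i
      · subst hj
        simp [r]
      · simp [r, Function.update_of_ne hj]) (by simp [r])).trans
      (hsub _ (hz k).1 _ (hz k).2.1 (hz k).2.2.1)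
  refine le_of_tendsto' ((hG (x, fun j => U j x, p, X) ⟨hx, trivial⟩).tendsto.comp
    (tendsto_nhdsWithin_iff.2 ⟨hzx.prodMk_nhds (hr.prodMk_nhds (hp.prodMk_nhds hX)),
      Eventually.of_forall fun k => ⟨(hz k).1, trivial⟩⟩)) hle

theorem upperSemicontinuousOn_sup'_add [Fintype ι] [Nonempty ι] {E : Type*} [TopologicalSpace E]
    {S : Set E} {U V : ι → E → ℝ} (hU : ∀ i, UpperSemicontinuousOn (U i) S)
    (hV : ∀ i, UpperSemicontinuousOn (V i) S) :
    UpperSemicontinuousOn (fun p : E × E => Finset.univ.sup' Finset.univ_nonempty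
      fun i => U i p.1 + V i p.2) (S ×ˢ S) := by
  intro p hp c hc
  simp only [Finset.sup'_lt_iff, Finset.mem_univ, true_implies] at hc ⊢
  refine eventually_all.2 fun i => ?_
  have h1 : UpperSemicontinuousOn (fun p : E × E => U i p.1) (S ×ˢ S) := fun p hp c hc =>
    (tendsto_nhdsWithin_iff.2 ⟨(continuous_fst.tendsto p).mono_left nhdsWithin_le_nhds,
      eventually_mem_nhdsWithin.mono fun q hq => hq.1⟩).eventually (hU i p.1 hp.1 c hc)
  have h2 : UpperSemicontinuousOn (fun p : E × E => V i p.2) (S ×ˢ S) := fun p hp c hc =>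
    (tendsto_nhdsWithin_iff.2 ⟨(continuous_snd.tendsto p).mono_left nhdsWithin_le_nhds,
      eventually_mem_nhdsWithin.mono fun q hq => hq.2⟩).eventually (hV i p.2 hp.2 c hc)
  exact h1.add h2 p hp c (hc i)

/-- Comparison for a system `G i` that is monotone in the off-diagonal unknowns, with a
subsolution `U` and a supersolution `-V`. -/
theorem add_nonpos_of_quasiMonotone [Finite ι] {Ω : Set (En n)} (hΩ : IsOpen Ω)
    (hΩb : IsBounded Ω) {G : ι → En n → (ι → ℝ) → En n → Symn n → ℝ}
    (hG : ∀ i, ContinuousOn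
      (fun q : En n × (ι → ℝ) × En n × Symn n => G i q.1 q.2.1 q.2.2.1 q.2.2.2) (Ω ×ˢ Set.univ))
    (hmono : ∀ i, ∀ x ∈ Ω, ∀ (r ρ : ι → ℝ) (p : En n) (X : Symn n), X.IsSymm →
      (∀ k, r k ≤ ρ k) → r i = ρ i → G i x ρ p X ≤ G i x r p X)
    {lam : ℝ} (hlam : 0 < lam)
    (hproper : ∀ i, ∀ x ∈ Ω, ∀ (r ρ : ι → ℝ) (p : En n) (X : Symn n), X.IsSymm →
      0 < r i - ρ i → (∀ k, r k - ρ k ≤ r i - ρ i) →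
      lam * (r i - ρ i) ≤ G i x r p X - G i x ρ p X)
    {ω : ℝ → ℝ} (hω : Continuous ω) (hω0 : ω 0 = 0)
    (hstruct : ∀ (X Y : Symn n), X.IsSymm → Y.IsSymm → ∀ α : ℝ, 0 < α →
      LoewnerLE ((-(3 * α)) • (1 : Matrix (Fin n ⊕ Fin n) (Fin n ⊕ Fin n) ℝ))
        (Matrix.fromBlocks X 0 0 Y) →
      LoewnerLE (Matrix.fromBlocks X 0 0 Y)
        ((3 * α) • Matrix.fromBlocks 1 (-1) (-1) (1 : Symn n)) →
      ∀ x ∈ Ω, ∀ y ∈ Ω, ∀ (r : ι → ℝ) i,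
        G i y r (α • (x - y)) (-Y) - G i x r (α • (x - y)) X ≤ ω (α * ‖x - y‖ ^ 2 + 1 / α))
    {U V : ι → En n → ℝ} (hU : ∀ k, UpperSemicontinuousOn (U k) (closure Ω))
    (hV : ∀ k, UpperSemicontinuousOn (V k) (closure Ω))
    (hsub : ∀ i, ∀ x ∈ Ω, ∀ φ : En n → ℝ, ContDiff ℝ 2 φ → TouchAbove Ω φ (U i) x →
      G i x (fun k => U k x) (gradient φ x) (hess φ x) ≤ 0)
    (hsuper : ∀ i, ∀ x ∈ Ω, ∀ φ : En n → ℝ, ContDiff ℝ 2 φ → TouchAbove Ω φ (V i) x →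
      0 ≤ G i x (fun k => -V k x) (-gradient φ x) (-hess φ x))
    (hbdry : ∀ x ∈ frontier Ω, ∀ i, U i x + V i x ≤ 0) :
    ∀ x ∈ Ω, ∀ i, U i x + V i x ≤ 0 := by
  classical
  have := Fintype.ofFinite ι
  intro x₀ hx₀ i₀
  by_contra! hpos
  have : Nonempty ι := ⟨i₀⟩
  set W : En n × En n → ℝ := fun p => Finset.univ.sup' Finset.univ_nonempty
    fun i => U i p.1 + V i p.2 with hWdef
  have hWle : ∀ i x y, U i x + V i y ≤ W (x, y) := fun i x y =>
    Finset.le_sup' (fun i => U i x + V i y) (Finset.mem_univ i)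
  have hθ : 0 < W (x₀, x₀) := hpos.trans_le (hWle i₀ x₀ x₀)
  obtain ⟨ε, hε, hωε⟩ := Metric.eventually_nhds_iff.1
    (hω.continuousAt.eventually (Iio_mem_nhds (by rw [hω0]; positivity : ω 0 < lam * W (x₀, x₀))))
  obtain ⟨α, hα, x, hx, y, hy, hsmall, hWxy, hmax⟩ :=
    exists_penalized_max hΩb.isCompact_closure hΩ (upperSemicontinuousOn_sup'_add hU hV)
      (subset_closure hx₀) hθ (fun x hx => Finset.sup'_le _ _ fun i _ =>
        hbdry x (by rwa [hΩ.frontier_eq]) i) hε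
  obtain ⟨i, -, hi⟩ := Finset.exists_mem_eq_sup' Finset.univ_nonempty fun i => U i x + V i y
  change W (x, y) = U i x + V i y at hi
  obtain ⟨X, Y, hX, hY, hle₁, hle₂, hJ₁, hJ₂⟩ := exists_limJets hΩ hΩb (hU i) (hV i) hx hy hα
    (fun x' hx' y' hy' => by
      rw [← hi]
      exact (sub_le_sub_right (hWle i x' y') _).trans (hmax x' hx' y' hy'))
  have h1 := hJ₁.nonpos (hG i) (hmono i) (fun k => (hU k).mono subset_closure) (hsub i) hx
  have h2 := hJ₂.nonpos (G := fun x r p X => -G i x (-r) (-p) (-X)) (i := i)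
    (((hG i).comp (f := fun q : En n × (ι → ℝ) × En n × Symn n =>
      (q.1, -q.2.1, -q.2.2.1, -q.2.2.2)) (by fun_prop) (fun q hq => ⟨hq.1, trivial⟩)).neg)
    (fun x hx r ρ p X hX hle heq => neg_le_neg (hmono i x hx (-ρ) (-r) (-p) (-X) hX.neg
      (fun k => neg_le_neg (hle k)) (by simp [heq])))
    (fun k => (hV k).mono subset_closure)
    (fun x hx φ hφ ht => neg_nonpos.2 (hsuper i x hx φ hφ ht)) hy
  have h3 := hstruct X Y hX hY α hα hle₁ hle₂ x hx y hy (-fun k => V k y) i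
  have h4 := hproper i x hx (fun k => U k x) (-fun k => V k y) (α • (x - y)) X hX
  simp only [Pi.neg_apply, sub_neg_eq_add, neg_neg] at h2 h4
  have h5 := h4 (by linarith) (fun k => by rw [← hi]; exact hWle k x y)
  have h6 : ω (α * ‖x - y‖ ^ 2 + 1 / α) < lam * W (x₀, x₀) := hωε (by
    rw [Real.dist_0_eq_abs, abs_of_nonneg (by positivity)]
    exact hsmall)
  have h7 : lam * W (x₀, x₀) ≤ lam * (U i x + V i y) :=
    mul_le_mul_of_nonneg_left (hi ▸ hWxy) hlam.le
  linarith

end ReducedSystem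

section Envelopes

variable {n : ℕ}

theorem uEnv_neg (Ω : Set (En n)) (f : En n → ℝ) (x : En n) :
    uEnv Ω (fun y => -f y) x = -lEnv Ω f x := by
  rw [uEnv, lEnv, limsup_eq, liminf_eq, Real.sInf_def]
  congr 2
  ext a
  simp

theorem upperSemicontinuousOn_uEnv {Ω : Set (En n)} {f : En n → ℝ} {M : ℝ}
    (hf : ∀ x ∈ Ω, |f x| ≤ M) : UpperSemicontinuousOn (uEnv Ω f) (closure Ω) := by
  intro x _ c hc
  obtain ⟨c', h1, h2⟩ := exists_between hc
  have hbdd : IsBoundedUnder (· ≤ ·) (𝓝[Ω] x) f :=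
    isBoundedUnder_of_eventually_le
      (eventually_mem_nhdsWithin.mono fun y hy => (abs_le.1 (hf y hy)).2)
  have h3 := eventually_lt_of_limsup_lt h1 hbdd
  rw [eventually_nhdsWithin_iff] at h3
  filter_upwards [eventually_mem_nhdsWithin,
    nhdsWithin_le_nhds (eventually_eventually_nhds.2 h3)] with y hy hy'
  have : (𝓝[Ω] y).NeBot := mem_closure_iff_nhdsWithin_neBot.1 hy
  have hcob : IsCoboundedUnder (· ≤ ·) (𝓝[Ω] y) f :=
    IsBoundedUnder.isCoboundedUnder_le (isBoundedUnder_of_eventually_ge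
      (eventually_mem_nhdsWithin.mono fun z hz => (abs_le.1 (hf z hz)).1))
  exact (limsup_le_of_le hcob ((eventually_nhdsWithin_iff.2 hy').mono fun _ h => h.le)).trans_lt h2

theorem TouchAbove.neg {Ω : Set (En n)} {φ f : En n → ℝ} {x : En n}
    (h : TouchAbove Ω φ (fun y => -f y) x) : TouchBelow Ω (fun y => -φ y) f x := by
  obtain ⟨h1, N, hN, hx, h2⟩ := h
  exact ⟨by simp [h1], N, hN, hx, fun y hy => by linarith [h2 y hy]⟩

theorem gradient_fun_neg (φ : En n → ℝ) (x : En n) :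
    gradient (fun y => -φ y) x = -gradient φ x := by
  simp [gradient, fderiv_fun_neg]

theorem hess_fun_neg (φ : En n → ℝ) (x : En n) : hess (fun y => -φ y) x = -hess φ x := by
  ext i j
  have : fderiv ℝ (fun y => -φ y) = fun y => -fderiv ℝ φ y := funext fun y => fderiv_fun_neg
  simp only [hess, Matrix.of_apply, Matrix.neg_apply, iteratedFDeriv_two_apply, this,
    fderiv_fun_neg, _root_.neg_apply]

theorem LoewnerLE.submatrix_swap {A B : Matrix (Fin n ⊕ Fin n) (Fin n ⊕ Fin n) ℝ}
    (h : LoewnerLE A B) :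
    LoewnerLE (A.submatrix Sum.swap Sum.swap) (B.submatrix Sum.swap Sum.swap) :=
  Matrix.PosSemidef.submatrix h Sum.swap

end Envelopes

/-- Comparison theorem: under degenerate ellipticity, balanced
quasi-monotonicity and conditions (i') and (ii), if (u1, u2) is a bounded sub-super
solution and (v1, v2) a bounded super-sub solution with u₁* ≤ v_{1*} and v₂* ≤ u_{2*}
on ∂Ω, then the same inequalities hold in Ω. -/
theorem comparison {n m₁ m₂ : ℕ} (hm₁ : 1 ≤ m₁)
    (Ω : Set (En n)) (hΩo : IsOpen Ω) (hΩb : IsBounded Ω)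
    (F1 : Fin m₁ → Op n m₁ m₂) (F2 : Fin m₂ → Op n m₁ m₂)
    (hF1c : ∀ j, OpContinuousOn Ω (F1 j)) (hF2c : ∀ j, OpContinuousOn Ω (F2 j))
    (hF1e : ∀ j, DegElliptic Ω (F1 j)) (hF2e : ∀ j, DegElliptic Ω (F2 j))
    (hQM : BalancedQM Ω F1 F2)
    -- condition (i'): if θ = max{max_j (r_j - ρ_j), max_j (σ_j - s_j)} > 0 then the
    -- stated lower bounds hold at every coordinate realizing θ
    (hi' : ∃ lam : ℝ, 0 < lam ∧ ∀ x ∈ Ω, ∀ (p : En n) (X : Symn n), X.IsSymm →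
      ∀ (r ρ : Fin m₁ → ℝ) (s σ : Fin m₂ → ℝ) (θ : ℝ), 0 < θ →
        (∀ k, r k - ρ k ≤ θ) → (∀ k, σ k - s k ≤ θ) →
        (∀ j, θ = r j - ρ j →
          lam * (r j - ρ j) ≤ F1 j x r s p X - F1 j x ρ σ p X) ∧
        (∀ j, θ = σ j - s j →
          lam * (σ j - s j) ≤ F2 j x ρ σ p X - F2 j x r s p X))
    -- condition (ii)
    (hii : ∃ ω : ℝ → ℝ, Continuous ω ∧ ω 0 = 0 ∧ (∀ t, 0 ≤ t → 0 ≤ ω t) ∧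
      ∀ (X Y : Symn n), X.IsSymm → Y.IsSymm → ∀ α : ℝ, 0 < α →
        LoewnerLE ((-(3 * α)) • (1 : Matrix (Fin n ⊕ Fin n) (Fin n ⊕ Fin n) ℝ))
          (Matrix.fromBlocks X 0 0 Y) →
        LoewnerLE (Matrix.fromBlocks X 0 0 Y)
          ((3 * α) • Matrix.fromBlocks 1 (-1) (-1) (1 : Symn n)) →
        ∀ x ∈ Ω, ∀ y ∈ Ω, ∀ (r : Fin m₁ → ℝ) (s : Fin m₂ → ℝ),
          (∀ j, F1 j y r s (α • (x - y)) (-Y) - F1 j x r s (α • (x - y)) X ≤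
            ω (α * ‖x - y‖ ^ 2 + 1 / α)) ∧
          (∀ j, F2 j y r s (α • (x - y)) (-Y) - F2 j x r s (α • (x - y)) X ≤
            ω (α * ‖x - y‖ ^ 2 + 1 / α)))
    (u1 v1 : En n → Fin m₁ → ℝ) (u2 v2 : En n → Fin m₂ → ℝ)
    (hu : SubSuper Ω F1 F2 u1 u2) (hv : SuperSub Ω F1 F2 v1 v2)
    (hbdry1 : ∀ x ∈ frontier Ω, ∀ j, uEnv Ω (fun y => u1 y j) x ≤ lEnv Ω (fun y => v1 y j) x)
    (hbdry2 : ∀ x ∈ frontier Ω, ∀ j, uEnv Ω (fun y => v2 y j) x ≤ lEnv Ω (fun y => u2 y j) x) :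
    (∀ x ∈ Ω, ∀ j, uEnv Ω (fun y => u1 y j) x ≤ lEnv Ω (fun y => v1 y j) x) ∧
    (∀ x ∈ Ω, ∀ j, uEnv Ω (fun y => v2 y j) x ≤ lEnv Ω (fun y => u2 y j) x) := by
  classical
  obtain ⟨hbu1, hbu2, hu1, hu2⟩ := hu
  obtain ⟨hbv1, hbv2, hv1, hv2⟩ := hv
  obtain ⟨lam, hlam, hi'⟩ := hi'
  obtain ⟨ω, hω, hω0, -, hii⟩ := hii
  obtain ⟨hQ1, hQ2, hQ3, hQ4⟩ := hQM
  have husc : ∀ {m : ℕ} {u : En n → Fin m → ℝ}, BddOn Ω u → ∀ j,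
      UpperSemicontinuousOn (uEnv Ω fun y => u y j) (closure Ω) ∧
      UpperSemicontinuousOn (fun x => -lEnv Ω (fun y => u y j) x) (closure Ω) := by
    rintro m u ⟨M, hM⟩ j
    refine ⟨upperSemicontinuousOn_uEnv fun x hx => hM x hx j, ?_⟩
    simp only [← uEnv_neg]
    exact upperSemicontinuousOn_uEnv fun x hx => by simpa using hM x hx j
  let G : Fin m₁ ⊕ Fin m₂ → En n → (Fin m₁ ⊕ Fin m₂ → ℝ) → En n → Symn n → ℝ := Sum.elim
    (fun j x R p X => F1 j x (fun k => R (.inl k)) (fun k => -R (.inr k)) p X)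
    (fun j x R p X => -F2 j x (fun k => R (.inl k)) (fun k => -R (.inr k)) (-p) (-X))
  let U : Fin m₁ ⊕ Fin m₂ → En n → ℝ := Sum.elim (fun j => uEnv Ω fun y => u1 y j)
    (fun j x => -lEnv Ω (fun y => u2 y j) x)
  let V : Fin m₁ ⊕ Fin m₂ → En n → ℝ := Sum.elim (fun j x => -lEnv Ω (fun y => v1 y j) x)
    (fun j => uEnv Ω fun y => v2 y j)
  have key : ∀ x ∈ Ω, ∀ i, U i x + V i x ≤ 0 := by
    refine add_nonpos_of_quasiMonotone hΩo hΩb (G := G) ?_ ?_ hlam ?_ hω hω0 ?_ ?_ ?_ ?_ ?_ ?_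
    · rintro (j | j)
      · exact (hF1c j).comp (f := fun q : En n × (Fin m₁ ⊕ Fin m₂ → ℝ) × En n × Symn n =>
          (q.1, (fun k => q.2.1 (.inl k)), (fun k => -q.2.1 (.inr k)), q.2.2.1, q.2.2.2))
          (by fun_prop) (fun q hq => ⟨hq.1, trivial⟩)
      · exact ((hF2c j).comp (f := fun q : En n × (Fin m₁ ⊕ Fin m₂ → ℝ) × En n × Symn n =>
          (q.1, (fun k => q.2.1 (.inl k)), (fun k => -q.2.1 (.inr k)), -q.2.2.1, -q.2.2.2))
          (by fun_prop) (fun q hq => ⟨hq.1, trivial⟩)).neg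
    · rintro (j | j) x hx r ρ p X hX hle heq
      · exact (hQ2 j x hx _ _ _ p X hX (fun k => hle (.inl k)) heq).trans
          (hQ1 j x hx _ _ _ p X hX fun k => neg_le_neg (hle (.inr k)))
      · exact neg_le_neg ((hQ3 j x hx _ _ _ (-p) (-X) hX.neg fun k => hle (.inl k)).trans
          (hQ4 j x hx _ _ _ (-p) (-X) hX.neg (fun k => neg_le_neg (hle (.inr k))) (by rw [heq])))
    · rintro (j | j) x hx r ρ p X hX hpos hle
      · exact (hi' x hx p X hX (fun k => r (.inl k)) (fun k => ρ (.inl k)) (fun k => -r (.inr k))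
          (fun k => -ρ (.inr k)) _ hpos (fun k => hle (.inl k))
          (fun k => by linarith [hle (.inr k)])).1 j rfl
      · have := (hi' x hx (-p) (-X) hX.neg (fun k => r (.inl k)) (fun k => ρ (.inl k))
          (fun k => -r (.inr k)) (fun k => -ρ (.inr k)) _ hpos (fun k => hle (.inl k))
          (fun k => by linarith [hle (.inr k)])).2 j (by ring)
        simp only [G, Sum.elim_inr]
        linarith
    · rintro X Y hX hY α hα h1 h2 x hx y hy r (j | j)
      · exact (hii X Y hX hY α hα h1 h2 x hx y hy _ _).1 j
      · have h1' := h1.submatrix_swap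
        have h2' := h2.submatrix_swap
        simp only [Matrix.submatrix_smul, Pi.smul_apply,
          Matrix.fromBlocks_submatrix_sum_swap_sum_swap,
          Matrix.submatrix_one _ Sum.swap_leftInverse.injective] at h1' h2'
        have h3 := (hii Y X hY hX α hα h1' h2' y hy x hx
          (fun k => r (.inl k)) (fun k => -r (.inr k))).2 j
        rw [norm_sub_rev] at h3
        simp only [G, Sum.elim_inr, neg_neg, ← smul_neg, neg_sub]
        linarith
    · rintro (j | j)
      exacts [(husc hbu1 j).1, (husc hbu2 j).2]
    · rintro (j | j)
      exacts [(husc hbv1 j).2, (husc hbv2 j).1]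
    · rintro (j | j) x hx φ hφ ht
      · simpa [G, U] using hu1 j x hx φ hφ ht
      · have := hu2 j x hx _ hφ.neg (TouchAbove.neg ht)
        simpa [G, U, gradient_fun_neg, hess_fun_neg] using this
    · rintro (j | j) x hx φ hφ ht
      · have := hv1 j x hx _ hφ.neg (TouchAbove.neg ht)
        simpa [G, V, gradient_fun_neg, hess_fun_neg] using this
      · simpa [G, V] using hv2 j x hx φ hφ ht
    · rintro x hx (j | j)
      · simpa [U, V] using hbdry1 x hx j
      · have := hbdry2 x hx j
        simp only [U, V, Sum.elim_inr]
        linarith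
  refine ⟨fun x hx j => ?_, fun x hx j => ?_⟩
  · have := key x hx (.inl j)
    simp only [U, V, Sum.elim_inl] at this
    linarith
  · have := key x hx (.inr j)
    simp only [U, V, Sum.elim_inr] at this
    linarith
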